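/- Fix an integer r ≥ 2 and let P be the generalised alignment r-pattern: the r-pattern on {1,…,2r} whose two edges are {1,…,r} and {r+1,…,2r} (the unique collectable r-pattern whose block partition consists of a single block, i.e., of type r). Let M_n be a uniformly random ordered r-matching of size n. Then L_P(M_n)/n^{1/r} converges in probability to 1/Γ((r+1)/r) as n → ∞, where Γ denotes the Gamma function. -/

import Mathlib

/-- An ordered `r`-matching of size `n`: a partition of `{1,…,r*n}` into `n`
edges, each of size `r`. -/
def IsOrderedMatching (r n : ℕ) (M : Finset (Finset ℕ)) : Prop :=
  M.card = n ∧ (∀ e ∈ M, e.card = r) ∧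
    (∀ e ∈ M, ∀ f ∈ M, e ≠ f → Disjoint e f) ∧
    M.biUnion id = Finset.Icc 1 (r * n)

/-- Two edges `e, f` form the pattern `P`: there is a strictly increasing map
on `e ∪ f` sending the pair `{e, f}` to the pair of edges of `P`. -/
def FormsPattern (e f : Finset ℕ) (P : Finset (Finset ℕ)) : Prop :=
  ∃ φ : ℕ → ℕ, StrictMonoOn φ (↑(e ∪ f) : Set ℕ) ∧
    ({e.image φ, f.image φ} : Finset (Finset ℕ)) = P

/-- An `r`-pattern: an ordered `r`-matching of size `2` (on `{1,…,2r}`). -/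
def IsPattern (r : ℕ) (P : Finset (Finset ℕ)) : Prop :=
  IsOrderedMatching r 2 P

/-- A collection of edges in which every pair of distinct edges forms `P`. -/
def IsPatternClique (P S : Finset (Finset ℕ)) : Prop :=
  ∀ e ∈ S, ∀ f ∈ S, e ≠ f → FormsPattern e f P

/-- `L_P(M)`: the maximum size of a sub-matching of `M` which is a `P`-clique. -/
noncomputable def cliqueSize (P M : Finset (Finset ℕ)) : ℕ :=
  sSup {k | ∃ S ⊆ M, IsPatternClique P S ∧ S.card = k}

/-- `L(M) = max_P L_P(M)`, the maximum over all `r`-patterns `P`. -/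
noncomputable def Lmax (r : ℕ) (M : Finset (Finset ℕ)) : ℕ :=
  sSup {k | ∃ P, IsPattern r P ∧ cliqueSize P M = k}

/-- The number of ordered `r`-matchings of size `n` (on `{1,…,r*n}`). -/
noncomputable def totalMatchings (r n : ℕ) : ℕ :=
  Nat.card {M : Finset (Finset ℕ) // IsOrderedMatching r n M}

/-- The number of ordered `r`-matchings `M` of size `n` for which
`L_P(M)/n^(1/r)` deviates from `b` by at least `ε`. -/
noncomputable def deviantMatchings (r : ℕ) (P : Finset (Finset ℕ)) (b ε : ℝ) (n : ℕ) : ℕ :=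
  Nat.card {M : Finset (Finset ℕ) // IsOrderedMatching r n M ∧
    ε ≤ |(cliqueSize P M : ℝ) / (n : ℝ) ^ ((1 : ℝ) / (r : ℝ)) - b|}

/-- For a uniformly random ordered `r`-matching `M_n` of size `n`, the random
variable `L_P(M_n)/n^(1/r)` converges in probability to `b` as `n → ∞`: for
every `ε > 0`, the proportion of ordered `r`-matchings of size `n` with
`|L_P(M)/n^(1/r) - b| ≥ ε` tends to `0`. -/
def CliqueSizeConvergesTo (r : ℕ) (P : Finset (Finset ℕ)) (b : ℝ) : Prop :=
  ∀ ε : ℝ, 0 < ε →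
    Filter.Tendsto (fun n => (deviantMatchings r P b ε n : ℝ) / (totalMatchings r n : ℝ))
      Filter.atTop (nhds 0)

/-- The generalised alignment `r`-pattern: its two edges are `{1,…,r}` and
`{r+1,…,2r}`. -/
def alignPattern (r : ℕ) : Finset (Finset ℕ) :=
  {Finset.Icc 1 r, Finset.Icc (r + 1) (2 * r)}

open MeasureTheory Filter
open scoped ENNReal Topology

namespace RandomMatching

variable {r : ℕ} {ι α β : Type*}

/-- The tuple `e` lies entirely to the left of the tuple `f`. -/
def Before [LT α] (e f : Fin r → α) : Prop := ∀ a b, e a < f b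

/-- The tuples indexed by `S` are pairwise separated. -/
def IsSeparated [LT α] (x : ι → Fin r → α) (S : Finset ι) : Prop :=
  ∀ i ∈ S, ∀ j ∈ S, i ≠ j → Before (x i) (x j) ∨ Before (x j) (x i)

/-- The family `x` contains `k` pairwise separated tuples. -/
def HasSeparated [LT α] (k : ℕ) (x : ι → Fin r → α) : Prop :=
  ∃ S : Finset ι, S.card = k ∧ IsSeparated x S

theorem hasSeparated_congr [LT α] [LT β] {x : ι → Fin r → α} {y : ι → Fin r → β} {k : ℕ}
    (h : ∀ i a j b, x i a < x j b ↔ y i a < y j b) :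
    HasSeparated k x ↔ HasSeparated k y := by
  simp only [HasSeparated, IsSeparated, Before, h]

/-! ### The alignment pattern -/

theorem formsPattern_align_of_lt {e f : Finset ℕ} (he : e.card = r) (hf : f.card = r)
    (h : ∀ a ∈ e, ∀ b ∈ f, a < b) : FormsPattern e f (alignPattern r) := by
  classical
  have hd : Disjoint e f := Finset.disjoint_left.2 fun a ha hb => (h a ha a hb).false
  set φ : ℕ → ℕ := fun v => ((e ∪ f).filter (· ≤ v)).card with hφ
  have hmono : StrictMonoOn φ (↑(e ∪ f) : Set ℕ) := by
    intro a ha b hb hab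
    refine Finset.card_lt_card ⟨fun w hw => ?_, fun hsub => ?_⟩
    · simp only [Finset.mem_filter] at hw ⊢
      exact ⟨hw.1, hw.2.trans hab.le⟩
    · have := hsub (Finset.mem_filter.2 ⟨Finset.mem_coe.1 hb, le_rfl⟩)
      exact absurd (Finset.mem_filter.1 this).2 (not_le.2 hab)
  have hinje : Set.InjOn φ e := hmono.injOn.mono (by simp)
  have hinjf : Set.InjOn φ f := hmono.injOn.mono (by simp)
  have hce : (e.image φ) = Finset.Icc 1 r := by
    refine Finset.eq_of_subset_of_card_le ?_ ?_
    · intro v hv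
      obtain ⟨a, ha, rfl⟩ := Finset.mem_image.1 hv
      refine Finset.mem_Icc.2 ⟨Finset.card_pos.2 ⟨a, by simp [ha]⟩, ?_⟩
      rw [← he]
      refine Finset.card_le_card fun w hw => ?_
      simp only [Finset.mem_filter, Finset.mem_union] at hw
      rcases hw.1 with h1 | h1
      · exact h1
      · exact absurd hw.2 (not_le.2 (h a ha w h1))
    · rw [Finset.card_image_of_injOn hinje, he]; simp
  have hcf : (f.image φ) = Finset.Icc (r + 1) (2 * r) := by
    refine Finset.eq_of_subset_of_card_le ?_ ?_
    · intro v hv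
      obtain ⟨b, hb, rfl⟩ := Finset.mem_image.1 hv
      refine Finset.mem_Icc.2 ⟨?_, ?_⟩
      · have hbe : b ∉ e := fun hbe => (h b hbe b hb).false
        rw [← he, ← Finset.card_insert_of_notMem hbe]
        refine Finset.card_le_card fun w hw => ?_
        rcases Finset.mem_insert.1 hw with rfl | hw
        · simp [hb]
        · simp [hw, (h w hw b hb).le]
      · refine (Finset.card_le_card (Finset.filter_subset _ _)).trans ?_
        rw [Finset.card_union_of_disjoint hd, he, hf]; omega
    · rw [Finset.card_image_of_injOn hinjf, hf, Nat.card_Icc]; omega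
  exact ⟨φ, hmono, by rw [hce, hcf, alignPattern]⟩

theorem formsPattern_symm {e f : Finset ℕ} {P : Finset (Finset ℕ)} (h : FormsPattern e f P) :
    FormsPattern f e P := by
  obtain ⟨φ, hφ, hP⟩ := h
  exact ⟨φ, by rwa [Finset.union_comm], by rwa [Finset.pair_comm]⟩

theorem formsPattern_align_iff {e f : Finset ℕ} (hr : 0 < r) (he : e.card = r) (hf : f.card = r) :
    FormsPattern e f (alignPattern r) ↔
      (∀ a ∈ e, ∀ b ∈ f, a < b) ∨ (∀ a ∈ e, ∀ b ∈ f, b < a) := by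
  classical
  constructor
  · rintro ⟨φ, hφ, hP⟩
    have key : ∀ {e f : Finset ℕ}, StrictMonoOn φ (↑(e ∪ f) : Set ℕ) →
        e.image φ = Finset.Icc 1 r → f.image φ = Finset.Icc (r + 1) (2 * r) →
        ∀ a ∈ e, ∀ b ∈ f, a < b := by
      intro e f hφ he hf a ha b hb
      have h1 : φ a ∈ Finset.Icc 1 r := he ▸ Finset.mem_image_of_mem φ ha
      have h2 : φ b ∈ Finset.Icc (r + 1) (2 * r) := hf ▸ Finset.mem_image_of_mem φ hb
      rw [Finset.mem_Icc] at h1 h2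
      exact (hφ.lt_iff_lt (by simp [ha]) (by simp [hb])).1 (by omega)
    have hne : Finset.Icc 1 r ≠ Finset.Icc (r + 1) (2 * r) := by
      intro h
      have : (1 : ℕ) ∈ Finset.Icc (r + 1) (2 * r) := h ▸ Finset.mem_Icc.2 ⟨le_rfl, hr⟩
      rw [Finset.mem_Icc] at this; omega
    have h1 : e.image φ ∈ alignPattern r := hP ▸ by simp
    have h2 : f.image φ ∈ alignPattern r := hP ▸ by simp
    have h3 : Finset.Icc 1 r ∈ ({e.image φ, f.image φ} : Finset (Finset ℕ)) := by
      rw [hP]; simp [alignPattern]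
    have h4 : Finset.Icc (r + 1) (2 * r) ∈ ({e.image φ, f.image φ} : Finset (Finset ℕ)) := by
      rw [hP]; simp [alignPattern]
    simp only [alignPattern, Finset.mem_insert, Finset.mem_singleton] at h1 h2 h3 h4
    rcases h1 with h1 | h1
    · have h5 : f.image φ = Finset.Icc (r + 1) (2 * r) := by
        rcases h4 with h4 | h4
        · exact absurd (h1.symm.trans h4.symm) hne
        · exact h4.symm
      exact Or.inl (key hφ h1 h5)
    · have h5 : f.image φ = Finset.Icc 1 r := by
        rcases h3 with h3 | h3
        · exact absurd (h3.trans h1) hne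
        · exact h3.symm
      exact Or.inr fun a ha b hb => key (by rwa [Finset.union_comm]) h5 h1 b hb a ha
  · rintro (h | h)
    · exact formsPattern_align_of_lt he hf h
    · exact formsPattern_symm (formsPattern_align_of_lt hf he fun a ha b hb => h b hb a ha)

theorem le_cliqueSize_iff {P M : Finset (Finset ℕ)} {k : ℕ} :
    k ≤ cliqueSize P M ↔ ∃ S ⊆ M, IsPatternClique P S ∧ S.card = k := by
  set A : Set ℕ := {k | ∃ S ⊆ M, IsPatternClique P S ∧ S.card = k} with hA
  have hne : A.Nonempty := ⟨0, ∅, by simp, by simp [IsPatternClique], rfl⟩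
  have hbdd : BddAbove A := by
    refine ⟨M.card, ?_⟩
    rintro _ ⟨S, hS, -, rfl⟩
    exact Finset.card_le_card hS
  constructor
  · intro h
    obtain ⟨S, hSM, hS, hc⟩ := Nat.sSup_mem hne hbdd
    obtain ⟨T, hTS, hT⟩ := Finset.exists_subset_card_eq (h.trans hc.ge)
    exact ⟨T, hTS.trans hSM, fun e he f hf => hS e (hTS he) f (hTS hf), hT⟩
  · exact fun h => le_csSup hbdd h

/-! ### Matchings and labelled matchings -/

/-- Labellings of the vertices `1, …, N` by the pairs in `ι × Fin r`. -/
abbrev Labelling (r : ℕ) (ι : Type*) (N : ℕ) := ι × Fin r ≃ Finset.Icc 1 N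

/-- The vertex tuples of a labelling. -/
def Labelling.tuples {N : ℕ} (τ : Labelling r ι N) : ι → Fin r → ℕ := fun i a => τ (i, a)

/-- The set of edges of a labelling. -/
def Labelling.edges [Fintype ι] {N : ℕ} (τ : Labelling r ι N) : Finset (Finset ℕ) :=
  Finset.univ.image fun i => Finset.univ.image (τ.tuples i)

theorem Labelling.tuples_inj {N : ℕ} (τ : Labelling r ι N) {i j : ι} {a b : Fin r} :
    τ.tuples i a = τ.tuples j b ↔ i = j ∧ a = b := by
  simp [Labelling.tuples, Subtype.ext_iff.symm]

theorem Labelling.edge_injective [NeZero r] {N : ℕ} (τ : Labelling r ι N) :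
    Function.Injective fun i => Finset.univ.image (τ.tuples i) := by
  intro i j h
  have h1 : τ.tuples i 0 ∈ Finset.univ.image (τ.tuples j) := by
    rw [← show Finset.univ.image (τ.tuples i) = Finset.univ.image (τ.tuples j) from h]; simp
  obtain ⟨b, -, hb⟩ := Finset.mem_image.1 h1
  exact (τ.tuples_inj.1 hb).1.symm

theorem Labelling.card_edge {N : ℕ} (τ : Labelling r ι N) (i : ι) :
    (Finset.univ.image (τ.tuples i)).card = r := by
  rw [Finset.card_image_of_injective _ fun a b h => (τ.tuples_inj.1 h).2]; simp

theorem Labelling.isOrderedMatching [NeZero r] [Fintype ι] {n : ℕ} (hn : Fintype.card ι = n)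
    (τ : Labelling r ι (r * n)) : IsOrderedMatching r n τ.edges := by
  refine ⟨?_, ?_, ?_, ?_⟩
  · rw [Labelling.edges, Finset.card_image_of_injective _ τ.edge_injective, Finset.card_univ, hn]
  · intro e he
    obtain ⟨i, -, rfl⟩ := Finset.mem_image.1 he
    exact τ.card_edge i
  · intro e he f hf hef
    obtain ⟨i, -, rfl⟩ := Finset.mem_image.1 he
    obtain ⟨j, -, rfl⟩ := Finset.mem_image.1 hf
    rw [Finset.disjoint_left]
    intro v hv hv'
    obtain ⟨a, -, rfl⟩ := Finset.mem_image.1 hv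
    obtain ⟨b, -, hb⟩ := Finset.mem_image.1 hv'
    exact hef (by rw [(τ.tuples_inj.1 hb).1])
  · ext v
    simp only [Labelling.edges, Finset.mem_biUnion, Finset.mem_image,
      Finset.mem_univ, true_and, id]
    constructor
    · rintro ⟨_, ⟨i, rfl⟩, hv⟩
      obtain ⟨a, -, rfl⟩ := Finset.mem_image.1 hv
      exact (τ (i, a)).2
    · intro hv
      exact ⟨_, ⟨(τ.symm ⟨v, hv⟩).1, rfl⟩,
        Finset.mem_image.2 ⟨(τ.symm ⟨v, hv⟩).2, by simp, by simp [Labelling.tuples]⟩⟩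

theorem exists_labelling [Fintype ι] {n : ℕ} (hn : Fintype.card ι = n)
    {M : Finset (Finset ℕ)} (hM : IsOrderedMatching r n M) :
    ∃ τ : Labelling r ι (r * n), τ.edges = M := by
  classical
  obtain ⟨hc, hcard, hdisj, hunion⟩ := hM
  have hιM : Fintype.card ι = Fintype.card M := by rw [hn, Fintype.card_coe, hc]
  let E : ι ≃ M := Fintype.equivOfCardEq hιM
  have enc : ∀ i, ∃ g : Fin r → ℕ, Function.Injective g ∧ Finset.univ.image g = (E i).1 := by
    intro i
    have h := hcard _ (E i).2
    refine ⟨(E i).1.orderEmbOfFin h, ((E i).1.orderEmbOfFin h).injective, ?_⟩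
    rw [Finset.image_orderEmbOfFin_univ]
  choose g hg hgE using enc
  have hgmem : ∀ i a, g i a ∈ (E i).1 := fun i a => hgE i ▸ Finset.mem_image_of_mem _ (by simp)
  have hmem : ∀ i a, g i a ∈ Finset.Icc 1 (r * n) := by
    intro i a
    rw [← hunion]
    exact Finset.mem_biUnion.2 ⟨_, (E i).2, hgmem i a⟩
  let t : ι × Fin r → Finset.Icc 1 (r * n) := fun p => ⟨g p.1 p.2, hmem p.1 p.2⟩
  have ht : Function.Injective t := by
    rintro ⟨i, a⟩ ⟨j, b⟩ h
    have h' : g i a = g j b := congrArg Subtype.val h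
    have hij : i = j := by
      by_contra hij
      have := hdisj _ (E i).2 _ (E j).2 fun h => hij (E.injective (Subtype.ext h))
      exact Finset.disjoint_left.1 this (hgmem i a) (h' ▸ hgmem j b)
    subst hij
    rw [hg i h']
  have hbij : Function.Bijective t := by
    rw [Fintype.bijective_iff_injective_and_card]
    refine ⟨ht, ?_⟩
    simp [hn, Nat.mul_comm]
  refine ⟨Equiv.ofBijective t hbij, ?_⟩
  ext e
  simp only [Labelling.edges, Finset.mem_image, Finset.mem_univ, true_and]
  constructor
  · rintro ⟨i, rfl⟩
    have : Finset.univ.image (Labelling.tuples (Equiv.ofBijective t hbij) i) = (E i).1 := hgE i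
    rw [this]; exact (E i).2
  · intro he
    refine ⟨E.symm ⟨e, he⟩, ?_⟩
    have : Finset.univ.image (Labelling.tuples (Equiv.ofBijective t hbij) (E.symm ⟨e, he⟩)) =
      (E (E.symm ⟨e, he⟩)).1 := hgE _
    rw [this]; simp

theorem Labelling.le_cliqueSize_iff [NeZero r] [Fintype ι] {N : ℕ}
    (τ : Labelling r ι N) {k : ℕ} :
    k ≤ cliqueSize (alignPattern r) τ.edges ↔ HasSeparated k τ.tuples := by
  classical
  have hpair : ∀ i j, FormsPattern (Finset.univ.image (τ.tuples i))
      (Finset.univ.image (τ.tuples j)) (alignPattern r) ↔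
      Before (τ.tuples i) (τ.tuples j) ∨ Before (τ.tuples j) (τ.tuples i) := by
    intro i j
    rw [formsPattern_align_iff (NeZero.pos r) (τ.card_edge i) (τ.card_edge j)]
    simp only [Finset.mem_image, Finset.mem_univ, true_and, forall_exists_index,
      forall_apply_eq_imp_iff, Before]
    exact or_congr_right forall_comm
  rw [RandomMatching.le_cliqueSize_iff]
  constructor
  · rintro ⟨S, hS, hcl, rfl⟩
    obtain ⟨T, -, hT⟩ := Finset.subset_image_iff.1 hS
    refine ⟨T, ?_, ?_⟩
    · rw [← hT, Finset.card_image_of_injective _ τ.edge_injective]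
    · intro i hi j hj hij
      refine (hpair i j).1 (hcl _ ?_ _ ?_ (τ.edge_injective.ne hij)) <;>
      · rw [← hT]
        exact Finset.mem_image_of_mem _ ‹_›
  · rintro ⟨T, rfl, hT⟩
    refine ⟨T.image fun i => Finset.univ.image (τ.tuples i),
      Finset.image_subset_image (Finset.subset_univ _), ?_,
      Finset.card_image_of_injective _ τ.edge_injective⟩
    intro e he f hf hef
    obtain ⟨i, hi, rfl⟩ := Finset.mem_image.1 he
    obtain ⟨j, hj, rfl⟩ := Finset.mem_image.1 hf
    exact (hpair i j).2 (hT i hi j hj fun h => hef (by rw [h]))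

theorem Labelling.edges_trans_eq [Fintype ι] {N : ℕ} {σ τ : Labelling r ι N}
    (ρ : Finset.Icc 1 N ≃ Finset.Icc 1 N) (h : σ.edges = τ.edges) :
    Labelling.edges (σ.trans ρ) = Labelling.edges (τ.trans ρ) := by
  classical
  let f : ℕ → ℕ := fun v => if h : v ∈ Finset.Icc 1 N then ρ ⟨v, h⟩ else v
  have key : ∀ σ : Labelling r ι N, Labelling.edges (σ.trans ρ) = σ.edges.image (Finset.image f) := by
    intro σ
    rw [Labelling.edges, Labelling.edges, Finset.image_image]
    refine Finset.image_congr fun i _ => ?_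
    simp only [Function.comp, Finset.image_image]
    refine Finset.image_congr fun a _ => ?_
    simp only [Labelling.tuples, f, Function.comp]
    rw [dif_pos (σ (i, a)).2]
    rfl
  rw [key, key, h]

/-- The number of ordered `r`-matchings of size `n` with an aligned sub-matching of size `k`. -/
noncomputable def longCount (r k n : ℕ) : ℕ :=
  Nat.card {M : Finset (Finset ℕ) // IsOrderedMatching r n M ∧ k ≤ cliqueSize (alignPattern r) M}

theorem finite_matchings (r n : ℕ) : Finite {M : Finset (Finset ℕ) // IsOrderedMatching r n M} := by
  classical
  refine Set.Finite.to_subtype (((Finset.Icc 1 (r * n)).powerset.powerset).finite_toSet.subset ?_)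
  intro M hM
  simp only [Finset.mem_coe, Finset.mem_powerset]
  intro e he
  rw [Finset.mem_powerset, ← hM.2.2.2]
  exact Finset.subset_biUnion_of_mem id he

theorem card_hasSeparated_mul [NeZero r] [Fintype ι] [DecidableEq ι] {n : ℕ}
    (hn : Fintype.card ι = n) (k : ℕ) :
    Nat.card {τ : Labelling r ι (r * n) // HasSeparated k τ.tuples} * totalMatchings r n =
      longCount r k n * Nat.card (Labelling r ι (r * n)) := by
  classical
  have := finite_matchings r n
  let Φ : Labelling r ι (r * n) → {M : Finset (Finset ℕ) // IsOrderedMatching r n M} :=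
    fun τ => ⟨τ.edges, τ.isOrderedMatching hn⟩
  have hsurj : Function.Surjective Φ := by
    rintro ⟨M, hM⟩
    obtain ⟨τ, hτ⟩ := exists_labelling hn hM
    exact ⟨τ, Subtype.ext hτ⟩
  have hfib : ∀ M M', Nonempty ({τ // Φ τ = M} ≃ {τ // Φ τ = M'}) := by
    intro M M'
    obtain ⟨τ, rfl⟩ := hsurj M
    obtain ⟨τ', rfl⟩ := hsurj M'
    let ρ : Finset.Icc 1 (r * n) ≃ Finset.Icc 1 (r * n) := τ.symm.trans τ'
    refine ⟨⟨fun σ => ⟨σ.1.trans ρ, ?_⟩, fun σ => ⟨σ.1.trans ρ.symm, ?_⟩, ?_, ?_⟩⟩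
    · refine Subtype.ext ?_
      have h := Labelling.edges_trans_eq ρ (congrArg Subtype.val σ.2)
      have h2 : τ.trans ρ = τ' := by ext; simp [ρ]
      exact h.trans (congrArg _ h2)
    · refine Subtype.ext ?_
      have h := Labelling.edges_trans_eq ρ.symm (congrArg Subtype.val σ.2)
      have h2 : τ'.trans ρ.symm = τ := by ext; simp [ρ]
      exact h.trans (congrArg _ h2)
    · intro σ; ext; simp
    · intro σ; ext; simp
  obtain ⟨c, hc⟩ : ∃ c, ∀ M, Nat.card {τ // Φ τ = M} = c := by
    by_cases hne : Nonempty {M : Finset (Finset ℕ) // IsOrderedMatching r n M}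
    · obtain ⟨M₀⟩ := hne
      exact ⟨_, fun M => Nat.card_congr (hfib M M₀).some⟩
    · exact ⟨0, fun M => absurd ⟨M⟩ hne⟩
  have hcount : ∀ p : {M : Finset (Finset ℕ) // IsOrderedMatching r n M} → Prop,
      Nat.card {τ // p (Φ τ)} = Nat.card {M // p M} * c := by
    intro p
    have e : {τ // p (Φ τ)} ≃ Σ M : {M // p M}, {τ // Φ τ = M.1} :=
      { toFun := fun τ => ⟨⟨Φ τ.1, τ.2⟩, ⟨τ.1, rfl⟩⟩
        invFun := fun s => ⟨s.2.1, by rw [s.2.2]; exact s.1.2⟩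
        left_inv := fun τ => rfl
        right_inv := by
          rintro ⟨⟨M, hM⟩, ⟨τ, hτ⟩⟩
          change Φ τ = M at hτ
          subst hτ
          rfl }
    have := Fintype.ofFinite {M // p M}
    rw [Nat.card_congr e, Nat.card_sigma, Finset.sum_congr rfl fun M _ => hc M.1]
    simp
  have h1 : Nat.card {τ : Labelling r ι (r * n) // HasSeparated k τ.tuples} = longCount r k n * c := by
    have h := hcount fun M => k ≤ cliqueSize (alignPattern r) M.1
    rw [longCount, ← Nat.card_congr (Equiv.subtypeSubtypeEquivSubtypeInter _ _), ← h]
    exact Nat.card_congr (Equiv.subtypeEquivRight fun τ => (τ.le_cliqueSize_iff).symm)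
  have h2 : Nat.card (Labelling r ι (r * n)) = totalMatchings r n * c := by
    have h := hcount fun _ => True
    rw [totalMatchings, ← Nat.card_congr (Equiv.subtypeUnivEquiv fun _ => trivial), h,
      Nat.card_congr (Equiv.subtypeUnivEquiv fun _ => trivial)]
  rw [h1, h2]; ring
/-! ### Volume of the configurations with many separated tuples -/

/-- The proportion of ordered `r`-matchings of size `n` with an aligned sub-matching of size
`k`. -/
noncomputable def longRatio (r k n : ℕ) : ℝ≥0∞ := longCount r k n / totalMatchings r n

theorem totalMatchings_pos [NeZero r] (n : ℕ) : 0 < totalMatchings r n := by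
  have := finite_matchings r n
  have e : Fin n × Fin r ≃ Finset.Icc 1 (r * n) :=
    Fintype.equivOfCardEq (by simp [Nat.mul_comm])
  have : Nonempty {M : Finset (Finset ℕ) // IsOrderedMatching r n M} :=
    ⟨⟨_, Labelling.isOrderedMatching (Fintype.card_fin n) e⟩⟩
  exact Nat.card_pos

theorem longRatio_le_one (k n : ℕ) : longRatio r k n ≤ 1 := by
  refine ENNReal.div_le_of_le_mul ?_
  rw [one_mul]
  have := finite_matchings r n
  have h : longCount r k n ≤ totalMatchings r n :=
    Nat.card_le_card_of_injective (fun M => ⟨M.1, M.2.1⟩)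
      fun M M' h => by simpa [Subtype.ext_iff] using h
  exact_mod_cast h

theorem card_labelling [Fintype ι] [DecidableEq ι] {n : ℕ} (hn : Fintype.card ι = n) :
    Nat.card (Labelling r ι (r * n)) = (r * n).factorial := by
  have e : ι × Fin r ≃ Finset.Icc 1 (r * n) :=
    Fintype.equivOfCardEq (by simp [hn, Nat.mul_comm])
  rw [Nat.card_eq_fintype_card, Fintype.card_equiv e]
  simp [hn, Nat.mul_comm]

theorem longRatio_eq_card_div [NeZero r] [Fintype ι] [DecidableEq ι] {n : ℕ}
    (hn : Fintype.card ι = n) (k : ℕ) :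
    longRatio r k n = (Nat.card {τ : Labelling r ι (r * n) // HasSeparated k τ.tuples} : ℝ≥0∞) /
      (r * n).factorial := by
  have h := card_hasSeparated_mul (r := r) hn k
  rw [card_labelling hn] at h
  have ht := totalMatchings_pos (r := r) n
  rw [longRatio, ENNReal.div_eq_div_iff]
  · rw [mul_comm]
    exact_mod_cast h.symm.trans (mul_comm _ _)
  · exact_mod_cast (Nat.factorial_pos _).ne'
  · exact ENNReal.natCast_ne_top _
  · exact_mod_cast ht.ne'
  · exact ENNReal.natCast_ne_top _

/-- The tuples of coordinates of `y`. -/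
def tuplesOf (y : ι × Fin r → α) : ι → Fin r → α := fun i a => y (i, a)

theorem card_perm_hasSeparated [Fintype ι] [DecidableEq ι] {n : ℕ}
    (hn : Fintype.card ι = n) (k : ℕ) {y : ι × Fin r → ℝ} (hy : Function.Injective y) :
    Nat.card {σ : Equiv.Perm (ι × Fin r) // HasSeparated k (tuplesOf (y ∘ σ))} =
      Nat.card {τ : Labelling r ι (r * n) // HasSeparated k τ.tuples} := by
  set S : Finset ℝ := Finset.univ.image y with hS
  have hSc : S.card = r * n := by
    rw [hS, Finset.card_image_of_injective _ hy]; simp [hn, Nat.mul_comm]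
  let o : S ≃o Finset.Icc 1 (r * n) :=
    (S.orderIsoOfFin hSc).symm.trans ((Finset.Icc 1 (r * n)).orderIsoOfFin (by simp))
  let g : ι × Fin r → S := fun p => ⟨y p, Finset.mem_image_of_mem _ (Finset.mem_univ p)⟩
  have hg : Function.Bijective g := by
    refine ⟨fun p q h => hy (congrArg Subtype.val h), ?_⟩
    rintro ⟨v, hv⟩
    obtain ⟨p, -, rfl⟩ := Finset.mem_image.1 hv
    exact ⟨p, rfl⟩
  let t : Labelling r ι (r * n) := (Equiv.ofBijective g hg).trans o.toEquiv
  have ht : ∀ p q, y p < y q ↔ (t p : ℕ) < t q := by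
    intro p q
    have h := o.lt_iff_lt (x := g p) (y := g q)
    exact h.symm
  refine Nat.card_congr (Equiv.subtypeEquiv (Equiv.equivCongr (Equiv.refl _) t) fun σ => ?_)
  refine hasSeparated_congr fun i a j b => ?_
  exact ht (σ (i, a)) (σ (j, b))

theorem measurableSet_hasSeparated [Fintype ι] (k : ℕ) :
    MeasurableSet {x : ι → Fin r → ℝ | HasSeparated k x} := by
  classical
  have hB : ∀ i j, Measurable fun x : ι → Fin r → ℝ => Before (x i) (x j) := by
    intro i j
    refine Measurable.forall fun a => Measurable.forall fun b => measurableSet_setOfPred.1 ?_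
    exact measurableSet_lt (by fun_prop) (by fun_prop)
  refine measurableSet_setOfPred.2 (Measurable.exists fun S => Measurable.and measurable_const ?_)
  exact Measurable.forall fun i => Measurable.imp measurable_const <|
    Measurable.forall fun j => Measurable.imp measurable_const <|
    Measurable.imp measurable_const (Measurable.or (hB i j) (hB j i))

theorem measurePreserving_uncurry [Fintype ι] :
    MeasurePreserving (fun (x : ι → Fin r → ℝ) (p : ι × Fin r) => x p.1 p.2) volume volume := by
  have hm : Measurable (fun (x : ι → Fin r → ℝ) (p : ι × Fin r) => x p.1 p.2) := by fun_prop
  refine ⟨hm, ?_⟩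
  rw [volume_pi]
  refine (Measure.pi_eq fun s hs => ?_).symm
  rw [Measure.map_apply hm (MeasurableSet.univ_pi hs)]
  have : (fun (x : ι → Fin r → ℝ) (p : ι × Fin r) => x p.1 p.2) ⁻¹' Set.univ.pi s =
      Set.univ.pi fun i => Set.univ.pi fun a => s (i, a) := by
    ext x; simp [Set.mem_pi]
  rw [this, Measure.pi_pi]
  simp_rw [volume_pi_pi]
  rw [Fintype.prod_prod_type]

theorem measurePreserving_tuplesOf [Fintype ι] :
    MeasurePreserving (tuplesOf : (ι × Fin r → ℝ) → ι → Fin r → ℝ) volume volume := by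
  have hm : Measurable (tuplesOf : (ι × Fin r → ℝ) → ι → Fin r → ℝ) := by
    unfold tuplesOf; fun_prop
  have h := measurePreserving_uncurry (r := r) (ι := ι)
  refine ⟨hm, ?_⟩
  conv_lhs => rw [← h.map_eq]
  rw [Measure.map_map hm h.measurable]
  exact Measure.map_id

theorem ae_injective {κ : Type*} [Fintype κ] :
    ∀ᵐ y : κ → ℝ, Function.Injective y := by
  have h : ∀ p q : κ, p ≠ q → ∀ᵐ y : κ → ℝ, y p ≠ y q := by
    classical
    intro p q hpq
    let s : Submodule ℝ (κ → ℝ) :=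
      LinearMap.ker (LinearMap.proj (R := ℝ) (φ := fun _ : κ => ℝ) p - LinearMap.proj q)
    have hs : s ≠ ⊤ := by
      intro h
      have : (Pi.single p 1 : κ → ℝ) ∈ s := h ▸ Submodule.mem_top
      simp [s, hpq] at this
    have h0 := Measure.addHaar_submodule volume s hs
    rw [ae_iff]
    refine measure_mono_null (fun y hy => ?_) h0
    simp only [ne_eq, not_not, Set.mem_ofPred_eq] at hy
    simp [s, hy]
  have h' : ∀ᵐ y : κ → ℝ, ∀ p q : κ, p ≠ q → y p ≠ y q := by
    simp only [ae_all_iff]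
    exact h
  filter_upwards [h'] with y hy p q hpq
  by_contra hne
  exact hy p q hne hpq

theorem ae_injective_uncurry [Fintype ι] :
    ∀ᵐ x : ι → Fin r → ℝ, Function.Injective fun p : ι × Fin r => x p.1 p.2 :=
  measurePreserving_uncurry.quasiMeasurePreserving.ae ae_injective

/-- The configurations of tuples in `I` with `k` pairwise separated tuples. -/
def separatedSet (r : ℕ) (ι : Type*) (I : Set ℝ) (k : ℕ) : Set (ι → Fin r → ℝ) :=
  {x | (∀ i a, x i a ∈ I) ∧ HasSeparated k x}

theorem measurableSet_forall_mem [Fintype ι] {I : Set ℝ} (hI : MeasurableSet I) :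
    MeasurableSet {x : ι → Fin r → ℝ | ∀ i a, x i a ∈ I} := by
  refine measurableSet_setOfPred.2 (Measurable.forall fun i => Measurable.forall fun a => ?_)
  have h : Measurable fun x : ι → Fin r → ℝ => x i a := by fun_prop
  exact measurableSet_setOfPred.1 (h hI)

theorem measurableSet_separatedSet [Fintype ι] {I : Set ℝ} (hI : MeasurableSet I) (k : ℕ) :
    MeasurableSet (separatedSet r ι I k) :=
  (measurableSet_forall_mem hI).inter (measurableSet_hasSeparated k)

theorem volume_separatedSet [NeZero r] [Fintype ι] {n : ℕ} (hn : Fintype.card ι = n)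
    {I : Set ℝ} (hI : MeasurableSet I) (k : ℕ) :
    volume (separatedSet r ι I k) = volume I ^ (r * n) * longRatio r k n := by
  classical
  set A : Set (ι × Fin r → ℝ) := tuplesOf ⁻¹' separatedSet r ι I k with hA
  set C : Set (ι × Fin r → ℝ) := Set.univ.pi fun _ => I with hC
  have hCm : MeasurableSet C := MeasurableSet.univ_pi fun _ => hI
  have hAm : MeasurableSet A :=
    measurePreserving_tuplesOf.measurable (measurableSet_separatedSet hI k)
  have hvA : volume A = volume (separatedSet r ι I k) :=
    measurePreserving_tuplesOf.measure_preimage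
      (measurableSet_separatedSet hI k).nullMeasurableSet
  have hvC : volume C = volume I ^ (r * n) := by
    rw [hC, volume_pi_pi]; simp [hn, Nat.mul_comm]
  have hσ : ∀ σ : Equiv.Perm (ι × Fin r), MeasurePreserving
      (fun y : ι × Fin r → ℝ => y ∘ σ) volume volume := by
    intro σ
    have h := volume_measurePreserving_piCongrLeft (fun _ : ι × Fin r => ℝ) σ.symm
    convert h using 1
    ext y p
    simp [MeasurableEquiv.piCongrLeft, Equiv.piCongrLeft, Equiv.piCongrLeft']
  have hsum : (r * n).factorial * volume A =
      ∫⁻ y, ∑ σ : Equiv.Perm (ι × Fin r), A.indicator 1 (y ∘ σ) := by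
    rw [lintegral_finsetSum']
    · have : ∀ σ : Equiv.Perm (ι × Fin r),
          ∫⁻ y, A.indicator (1 : (ι × Fin r → ℝ) → ℝ≥0∞) (y ∘ σ) = volume A := by
        intro σ
        rw [(hσ σ).lintegral_comp (measurable_one.indicator hAm), lintegral_indicator_one hAm]
      rw [Finset.sum_congr rfl fun σ _ => this σ, Finset.sum_const, Finset.card_univ,
        Fintype.card_perm]
      simp [hn, Nat.mul_comm]
    · exact fun σ _ => ((measurable_one.indicator hAm).comp (hσ σ).measurable).aemeasurable
  have hval : ∀ᵐ y : ι × Fin r → ℝ,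
      ∑ σ : Equiv.Perm (ι × Fin r), A.indicator (1 : (ι × Fin r → ℝ) → ℝ≥0∞) (y ∘ σ) =
      C.indicator (fun _ => (Nat.card {τ : Labelling r ι (r * n) //
        HasSeparated k τ.tuples} : ℝ≥0∞)) y := by
    filter_upwards [ae_injective] with y hy
    rw [← card_perm_hasSeparated hn k hy]
    by_cases hyC : y ∈ C
    · rw [Set.indicator_of_mem hyC]
      have h1 : ∀ σ : Equiv.Perm (ι × Fin r), y ∘ σ ∈ A ↔ HasSeparated k (tuplesOf (y ∘ σ)) := by
        intro σ
        refine ⟨fun h => h.2, fun h => ⟨fun i a => ?_, h⟩⟩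
        exact hyC _ (Set.mem_univ _)
      simp only [Set.indicator_apply, h1, Pi.one_apply, Finset.sum_boole,
        Nat.card_eq_fintype_card, Fintype.card_subtype]
    · rw [Set.indicator_of_notMem hyC]
      refine Finset.sum_eq_zero fun σ _ => Set.indicator_of_notMem (fun h => hyC ?_) _
      intro p _
      have := h.1 (σ.symm p).1 (σ.symm p).2
      simpa [tuplesOf] using this
  rw [lintegral_congr_ae hval, lintegral_indicator_const hCm, hvC] at hsum
  have hf0 : ((r * n).factorial : ℝ≥0∞) ≠ 0 := by exact_mod_cast (Nat.factorial_pos _).ne'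
  rw [← hvA, longRatio_eq_card_div hn, ← mul_div_assoc, mul_comm (volume I ^ _),
    ENNReal.eq_div_iff hf0 (ENNReal.natCast_ne_top _), hsum]
/-! ### Splitting off the leftmost tuple -/

/-- The largest entry of a tuple. -/
noncomputable def top [NeZero r] (e : Fin r → ℝ) : ℝ :=
  Finset.univ.sup' Finset.univ_nonempty e

theorem le_top [NeZero r] (e : Fin r → ℝ) (a : Fin r) : e a ≤ top e :=
  Finset.le_sup' e (Finset.mem_univ a)

theorem top_le_iff [NeZero r] {e : Fin r → ℝ} {y : ℝ} : top e ≤ y ↔ ∀ a, e a ≤ y := by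
  simp [top]

theorem top_lt_iff [NeZero r] {e : Fin r → ℝ} {y : ℝ} : top e < y ↔ ∀ a, e a < y := by
  simp [top]

theorem exists_eq_top [NeZero r] (e : Fin r → ℝ) : ∃ a, e a = top e := by
  obtain ⟨a, -, ha⟩ := Finset.exists_mem_eq_sup' Finset.univ_nonempty e
  exact ⟨a, ha.symm⟩

theorem measurable_top [NeZero r] : Measurable (top : (Fin r → ℝ) → ℝ) := by
  have : Continuous (top : (Fin r → ℝ) → ℝ) :=
    Continuous.finset_sup'_apply _ fun a _ => continuous_apply a
  exact this.measurable

theorem Before.top_lt [NeZero r] {e f : Fin r → ℝ} (h : Before e f) (a : Fin r) : top e < f a :=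
  top_lt_iff.2 fun b => h b a

/-- The family `x` contains `k` pairwise separated tuples lying to the right of `y`. -/
def HasSeparatedAfter (y : ℝ) (k : ℕ) (x : ι → Fin r → ℝ) : Prop :=
  ∃ S : Finset ι, S.card = k ∧ (∀ i ∈ S, ∀ a, y < x i a) ∧ IsSeparated x S

theorem hasSeparated_succ_iff [NeZero r] {n k : ℕ} {x : Fin (n + 1) → Fin r → ℝ} {i : Fin (n + 1)}
    (hi : ∀ j, top (x i) ≤ top (x j)) :
    HasSeparated (k + 1) x ↔ HasSeparatedAfter (top (x i)) k fun j => x (i.succAbove j) := by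
  constructor
  · rintro ⟨S, hS, hx⟩
    obtain ⟨j₀, hj₀, hmin⟩ := Finset.exists_min_image S (fun j => top (x j))
      (Finset.card_pos.1 (by omega))
    have hafter : ∀ j ∈ S.erase j₀, ∀ a, top (x j₀) < x j a := by
      intro j hj a
      have hjS := Finset.mem_of_mem_erase hj
      rcases hx j₀ hj₀ j hjS (Finset.ne_of_mem_erase hj).symm with h | h
      · exact h.top_lt a
      · obtain ⟨b, hb⟩ := exists_eq_top (x j₀)
        have := h.top_lt b
        exact absurd (hmin j hjS) (by linarith)
    have hiS : i ∉ S.erase j₀ := by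
      intro h
      obtain ⟨b, hb⟩ := exists_eq_top (x i)
      have := hafter i h b
      linarith [hi j₀]
    refine ⟨Finset.univ.filter fun j => i.succAbove j ∈ S.erase j₀, ?_, ?_, ?_⟩
    · have hc : (S.erase j₀).card = k := by rw [Finset.card_erase_of_mem hj₀, hS]; rfl
      rw [← hc, ← Finset.card_map i.succAboveEmb]
      congr 1
      ext j
      simp only [Finset.mem_map, Finset.mem_filter, Finset.mem_univ, true_and, Fin.coe_succAboveEmb]
      constructor
      · rintro ⟨a, ha, rfl⟩
        exact ha
      · intro hj
        obtain ⟨a, ha⟩ := Fin.exists_succAbove_eq (x := j) (y := i) (fun h => hiS (h ▸ hj))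
        exact ⟨a, ha ▸ hj, ha⟩
    · intro j hj a
      exact (hi j₀).trans_lt (hafter _ (Finset.mem_filter.1 hj).2 a)
    · intro j hj l hl hjl
      exact hx _ (Finset.mem_of_mem_erase (Finset.mem_filter.1 hj).2) _
        (Finset.mem_of_mem_erase (Finset.mem_filter.1 hl).2)
        (Fin.succAbove_right_injective.ne hjl)
  · rintro ⟨T, hT, hafter, hx⟩
    have hB : ∀ j ∈ T, Before (x i) (x (i.succAbove j)) :=
      fun j hj a b => (le_top _ a).trans_lt (hafter j hj b)
    refine ⟨Finset.cons i (T.map i.succAboveEmb) ?_, ?_, ?_⟩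
    · simp [Fin.succAbove_ne]
    · simp [hT]
    · intro j hj l hl hjl
      rw [Finset.mem_cons, Finset.mem_map] at hj hl
      rcases hj with rfl | ⟨j, hj, rfl⟩ <;> rcases hl with rfl | ⟨l, hl, rfl⟩
      · exact absurd rfl hjl
      · exact Or.inl (hB l hl)
      · exact Or.inr (hB j hj)
      · exact hx j hj l hl fun h => hjl (by rw [h])

theorem hasSeparatedAfter_iff {y : ℝ} {k : ℕ} {x : ι → Fin r → ℝ} (A : Finset ι)
    (hA : ∀ i, i ∈ A ↔ ∀ a, y < x i a) :
    HasSeparatedAfter y k x ↔ HasSeparated k fun i : {i // i ∈ A} => x i := by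
  classical
  constructor
  · rintro ⟨S, hS, hy, hx⟩
    refine ⟨S.subtype (· ∈ A), ?_, ?_⟩
    · rw [Finset.card_subtype, Finset.filter_true_of_mem fun i hi => (hA i).2 (hy i hi), hS]
    · intro i hi j hj hij
      exact hx i (Finset.mem_subtype.1 hi) j (Finset.mem_subtype.1 hj)
        fun h => hij (Subtype.ext h)
  · rintro ⟨T, hT, hx⟩
    refine ⟨T.map (Function.Embedding.subtype _), by simp [hT], ?_, ?_⟩
    · intro i hi
      obtain ⟨i, -, rfl⟩ := Finset.mem_map.1 hi
      exact (hA _).1 i.2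
    · intro i hi j hj hij
      obtain ⟨i, hiT, rfl⟩ := Finset.mem_map.1 hi
      obtain ⟨j, hjT, rfl⟩ := Finset.mem_map.1 hj
      exact hx i hiT j hjT fun h => hij (by rw [h])

/-- The tuples in `(0, l]` that straddle `y`. -/
def straddle (r : ℕ) [NeZero r] (l y : ℝ) : Set (Fin r → ℝ) :=
  {e | (∀ a, e a ∈ Set.Ioc 0 l) ∧ y < top e ∧ ¬ ∀ a, y < e a}

theorem measurableSet_box (I : Set ℝ) (hI : MeasurableSet I) :
    MeasurableSet {e : Fin r → ℝ | ∀ a, e a ∈ I} := by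
  have : {e : Fin r → ℝ | ∀ a, e a ∈ I} = Set.univ.pi fun _ => I := by ext; simp
  rw [this]
  exact MeasurableSet.univ_pi fun _ => hI

theorem volume_box (I : Set ℝ) : volume {e : Fin r → ℝ | ∀ a, e a ∈ I} = volume I ^ r := by
  have : {e : Fin r → ℝ | ∀ a, e a ∈ I} = Set.univ.pi fun _ => I := by ext; simp
  rw [this, volume_pi_pi]; simp

theorem measurableSet_straddle [NeZero r] (l y : ℝ) : MeasurableSet (straddle r l y) := by
  refine (measurableSet_box _ measurableSet_Ioc).inter
    ((measurableSet_lt measurable_const measurable_top).inter ?_)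
  exact (measurableSet_box (Set.Ioi y) measurableSet_Ioi).compl

theorem volume_straddle [NeZero r] {l y : ℝ} (hy : 0 ≤ y) (hyl : y ≤ l) :
    volume (straddle r l y) = ENNReal.ofReal (l ^ r - y ^ r - (l - y) ^ r) := by
  have hr : r ≠ 0 := NeZero.ne r
  have e0 : Nonempty (Fin r) := ⟨0⟩
  set B : Set (Fin r → ℝ) := {e | ∀ a, e a ∈ Set.Ioc y l}
  set C : Set (Fin r → ℝ) := {e | ∀ a, e a ∈ Set.Ioc 0 y}
  set D : Set (Fin r → ℝ) := {e | ∀ a, e a ∈ Set.Ioc 0 l}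
  have hBm : MeasurableSet B := measurableSet_box _ measurableSet_Ioc
  have hCm : MeasurableSet C := measurableSet_box _ measurableSet_Ioc
  have hBD : B ⊆ D := fun e he a => ⟨hy.trans_lt (he a).1, (he a).2⟩
  have hCD : C ⊆ D \ B := fun e he =>
    ⟨fun a => ⟨(he a).1, (he a).2.trans hyl⟩, fun h => (((h 0).1.trans_le (he 0).2)).false⟩
  have hS : straddle r l y = (D \ B) \ C := by
    ext e
    simp only [straddle, B, C, D, Set.mem_ofPred_eq, Set.mem_sdiff, Set.mem_Ioc]
    constructor
    · rintro ⟨h1, h2, h3⟩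
      refine ⟨⟨h1, fun h => h3 fun a => (h a).1⟩, fun h => ?_⟩
      exact absurd (top_le_iff.2 fun a => (h a).2) (not_le.2 h2)
    · rintro ⟨⟨h1, h2⟩, h3⟩
      refine ⟨h1, ?_, fun h => h2 fun a => ⟨h a, (h1 a).2⟩⟩
      by_contra h
      exact h3 fun a => ⟨(h1 a).1, top_le_iff.1 (not_lt.1 h) a⟩
  have hvB : volume B = ENNReal.ofReal ((l - y) ^ r) := by
    rw [volume_box, Real.volume_Ioc, ENNReal.ofReal_pow (by linarith)]
  have hvC : volume C = ENNReal.ofReal (y ^ r) := by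
    rw [volume_box, Real.volume_Ioc, sub_zero, ENNReal.ofReal_pow hy]
  have hvD : volume D = ENNReal.ofReal (l ^ r) := by
    rw [volume_box, Real.volume_Ioc, sub_zero, ENNReal.ofReal_pow (by linarith)]
  rw [hS, measure_sdiff hCD hCm.nullMeasurableSet (by simp [hvC]),
    measure_sdiff hBD hBm.nullMeasurableSet (by simp [hvB]), hvB, hvC, hvD,
    ← ENNReal.ofReal_sub _ (pow_nonneg (by linarith) r), ← ENNReal.ofReal_sub _ (pow_nonneg hy r)]
  congr 1; ring

/-- The configurations of tuples in `(0, l]`, none of which ends before `y`, with `k` pairwise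
separated tuples to the right of `y`. -/
def afterSet (r : ℕ) [NeZero r] (ι : Type*) (l y : ℝ) (k : ℕ) : Set (ι → Fin r → ℝ) :=
  {x | (∀ i a, x i a ∈ Set.Ioc 0 l) ∧ (∀ i, y < top (x i)) ∧ HasSeparatedAfter y k x}

/-- The part of `afterSet` where the tuples to the right of `y` are those indexed by `A`. -/
def afterPiece (r : ℕ) [NeZero r] {ι : Type*} (l y : ℝ) (k : ℕ) (A : Finset ι) :
    Set (ι → Fin r → ℝ) :=
  {x | (fun i : {i // i ∈ A} => x i) ∈ separatedSet r {i // i ∈ A} (Set.Ioc y l) k ∧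
    ∀ i : {i // i ∉ A}, x i ∈ straddle r l y}

theorem afterPiece_mem_iff [NeZero r] {l y : ℝ} {k : ℕ} {A : Finset ι} {x : ι → Fin r → ℝ}
    (hx : x ∈ afterPiece r l y k A) (i : ι) : i ∈ A ↔ ∀ a, y < x i a := by
  refine ⟨fun hi a => (hx.1.1 ⟨i, hi⟩ a).1, fun h => ?_⟩
  by_contra hi
  exact (hx.2 ⟨i, hi⟩).2.2 h

theorem afterSet_eq_iUnion [NeZero r] [Fintype ι] {l y : ℝ} (hy : 0 ≤ y) (k : ℕ) :
    afterSet r ι l y k = ⋃ A : Finset ι, afterPiece r l y k A := by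
  classical
  ext x
  simp only [Set.mem_iUnion]
  constructor
  · rintro ⟨h1, h2, h3⟩
    let A : Finset ι := Finset.univ.filter fun i => ∀ a, y < x i a
    have hA : ∀ i, i ∈ A ↔ ∀ a, y < x i a := fun i => by simp [A]
    refine ⟨A, ⟨⟨fun i a => ⟨(hA i).1 i.2 a, (h1 i a).2⟩, (hasSeparatedAfter_iff A hA).1 h3⟩, ?_⟩⟩
    exact fun i => ⟨h1 i, h2 i, fun h => i.2 ((hA i).2 h)⟩
  · rintro ⟨A, hx⟩
    have hA := afterPiece_mem_iff hx
    refine ⟨fun i a => ?_, fun i => ?_, (hasSeparatedAfter_iff A hA).2 hx.1.2⟩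
    · by_cases hi : i ∈ A
      · have := hx.1.1 ⟨i, hi⟩ a
        exact ⟨hy.trans_lt this.1, this.2⟩
      · exact (hx.2 ⟨i, hi⟩).1 a
    · by_cases hi : i ∈ A
      · exact ((hA i).1 hi 0).trans_le (le_top _ 0)
      · exact (hx.2 ⟨i, hi⟩).2.1

theorem afterPiece_eq_preimage [NeZero r] [Fintype ι] {l y : ℝ} {k : ℕ} (A : Finset ι)
    [DecidablePred (· ∈ A)] :
    afterPiece r l y k A =
      (MeasurableEquiv.piEquivPiSubtypeProd (fun _ : ι => Fin r → ℝ) (· ∈ A)) ⁻¹'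
        (separatedSet r {i // i ∈ A} (Set.Ioc y l) k ×ˢ
          Set.univ.pi fun _ : {i // i ∉ A} => straddle r l y) := by
  ext x
  simp [afterPiece, MeasurableEquiv.piEquivPiSubtypeProd, Equiv.piEquivPiSubtypeProd]

theorem measurableSet_afterPiece [NeZero r] [Fintype ι] {l y : ℝ} {k : ℕ} (A : Finset ι) :
    MeasurableSet (afterPiece r l y k A) := by
  classical
  rw [afterPiece_eq_preimage]
  exact (MeasurableEquiv.measurable _) ((measurableSet_separatedSet measurableSet_Ioc k).prod
    (MeasurableSet.univ_pi fun _ => measurableSet_straddle l y))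

theorem volume_afterPiece [NeZero r] [Fintype ι] {n : ℕ} (hn : Fintype.card ι = n) {l y : ℝ}
    (k : ℕ) (A : Finset ι) :
    volume (afterPiece r l y k A) = ENNReal.ofReal (l - y) ^ (r * A.card) *
      longRatio r k A.card * volume (straddle r l y) ^ (n - A.card) := by
  classical
  have hms : MeasurableSet (separatedSet r {i // i ∈ A} (Set.Ioc y l) k ×ˢ
      Set.univ.pi fun _ : {i // i ∉ A} => straddle r l y) :=
    (measurableSet_separatedSet measurableSet_Ioc k).prod
      (MeasurableSet.univ_pi fun _ => measurableSet_straddle l y)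
  rw [afterPiece_eq_preimage,
    (volume_preserving_piEquivPiSubtypeProd (fun _ : ι => Fin r → ℝ) (· ∈ A)).measure_preimage
      hms.nullMeasurableSet, Measure.volume_eq_prod, Measure.prod_prod, volume_pi_pi,
    @volume_separatedSet r _ _ (Subtype.fintype _) A.card (by simp) _ measurableSet_Ioc, Real.volume_Ioc]
  simp [Fintype.card_subtype_compl, hn]

theorem volume_afterSet [NeZero r] [Fintype ι] {n : ℕ} (hn : Fintype.card ι = n) {l y : ℝ}
    (hy : 0 ≤ y) (k : ℕ) :
    volume (afterSet r ι l y k) = ∑ m ∈ Finset.range (n + 1),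
      n.choose m * (ENNReal.ofReal (l - y) ^ (r * m) * longRatio r k m *
        volume (straddle r l y) ^ (n - m)) := by
  classical
  rw [afterSet_eq_iUnion hy, measure_iUnion, tsum_fintype]
  · simp_rw [volume_afterPiece hn]
    rw [← Finset.powerset_univ, Finset.sum_powerset_apply_card (fun m =>
      ENNReal.ofReal (l - y) ^ (r * m) * longRatio r k m * volume (straddle r l y) ^ (n - m))]
    simp [hn]
  · intro A A' hAA'
    refine Set.disjoint_left.2 fun x hx hx' => hAA' ?_
    ext i
    rw [afterPiece_mem_iff hx, afterPiece_mem_iff hx']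
  · exact measurableSet_afterPiece

/-- The tuples with all entries in `(0, l]`. -/
def box (r : ℕ) (l : ℝ) : Set (Fin r → ℝ) := {e | ∀ a, e a ∈ Set.Ioc 0 l}

theorem measurableSet_box_Ioc (l : ℝ) : MeasurableSet (box r l) :=
  measurableSet_box _ measurableSet_Ioc

theorem top_mem_of_mem_box [NeZero r] {l : ℝ} {e : Fin r → ℝ} (he : e ∈ box r l) :
    top e ∈ Set.Ioc 0 l :=
  ⟨(he 0).1.trans_le (le_top e 0), top_le_iff.2 fun a => (he a).2⟩

/-- The pairs consisting of a leftmost tuple and the family of the remaining tuples, with `k`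
pairwise separated tuples to the right of the leftmost one. -/
def leftmostSet (r : ℕ) [NeZero r] (n : ℕ) (l : ℝ) (k : ℕ) :
    Set ((Fin r → ℝ) × (Fin n → Fin r → ℝ)) :=
  {p | p.1 ∈ box r l ∧ p.2 ∈ afterSet r (Fin n) l (top p.1) k}

theorem measurableSet_leftmostSet [NeZero r] (n : ℕ) (l : ℝ) (k : ℕ) :
    MeasurableSet (leftmostSet r n l k) := by
  have hB : ∀ i j, Measurable fun p : (Fin r → ℝ) × (Fin n → Fin r → ℝ) =>
      Before (p.2 i) (p.2 j) := by
    intro i j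
    refine Measurable.forall fun a => Measurable.forall fun b => measurableSet_setOfPred.1 ?_
    exact measurableSet_lt (by fun_prop) (by fun_prop)
  have ht : Measurable fun p : (Fin r → ℝ) × (Fin n → Fin r → ℝ) => top p.1 :=
    measurable_top.comp measurable_fst
  refine (measurable_fst (measurableSet_box_Ioc l)).inter ?_
  refine (measurable_snd (measurableSet_forall_mem measurableSet_Ioc)).inter (.inter ?_ ?_)
  · refine measurableSet_setOfPred.2 (Measurable.forall fun i => measurableSet_setOfPred.1 ?_)
    exact measurableSet_lt ht (measurable_top.comp (by fun_prop))
  · refine measurableSet_setOfPred.2 (Measurable.exists fun S => Measurable.and measurable_const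
      (Measurable.and ?_ ?_))
    · refine Measurable.forall fun i => Measurable.imp measurable_const <|
        Measurable.forall fun a => measurableSet_setOfPred.1 ?_
      exact measurableSet_lt ht (by fun_prop)
    · exact Measurable.forall fun i => Measurable.imp measurable_const <|
        Measurable.forall fun j => Measurable.imp measurable_const <|
        Measurable.imp measurable_const (Measurable.or (hB i j) (hB j i))

theorem measurable_volume_afterSet [NeZero r] (n : ℕ) (l : ℝ) (k : ℕ) :
    Measurable fun e => (box r l).indicator
      (fun e => volume (afterSet r (Fin n) l (top e) k)) e := by
  have h := measurable_measure_prodMk_left (ν := (volume : Measure (Fin n → Fin r → ℝ)))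
    (measurableSet_leftmostSet (r := r) n l k)
  convert h using 2 with e
  by_cases he : e ∈ box r l
  · rw [Set.indicator_of_mem he]
    congr 1
    ext x
    simp [leftmostSet, he]
  · rw [Set.indicator_of_notMem he]
    have : Prod.mk e ⁻¹' leftmostSet r n l k = ∅ := by
      ext x
      simp [leftmostSet, he]
    rw [this, measure_empty]

theorem volume_leftmostSet [NeZero r] (n : ℕ) (l : ℝ) (k : ℕ) :
    volume (leftmostSet r n l k) = ∫⁻ e in box r l, volume (afterSet r (Fin n) l (top e) k) := by
  rw [Measure.volume_eq_prod, Measure.prod_apply (measurableSet_leftmostSet n l k),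
    ← lintegral_indicator (measurableSet_box_Ioc l)]
  refine lintegral_congr fun e => ?_
  by_cases he : e ∈ box r l
  · rw [Set.indicator_of_mem he]
    congr 1
    ext x
    simp [leftmostSet, he]
  · rw [Set.indicator_of_notMem he]
    have : Prod.mk e ⁻¹' leftmostSet r n l k = ∅ := by
      ext x
      simp [leftmostSet, he]
    rw [this, measure_empty]

theorem mem_preimage_leftmostSet_iff [NeZero r] {n : ℕ} {l : ℝ} {k : ℕ} {i : Fin (n + 1)}
    {x : Fin (n + 1) → Fin r → ℝ} :
    x ∈ MeasurableEquiv.piFinSuccAbove (fun _ => Fin r → ℝ) i ⁻¹' leftmostSet r n l k ↔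
      (∀ j ≠ i, top (x i) < top (x j)) ∧ x ∈ separatedSet r (Fin (n + 1)) (Set.Ioc 0 l) (k + 1) := by
  have hx : ∀ j, (MeasurableEquiv.piFinSuccAbove (fun _ => Fin r → ℝ) i x).2 j =
      x (i.succAbove j) := fun j => rfl
  have hx1 : (MeasurableEquiv.piFinSuccAbove (fun _ => Fin r → ℝ) i x).1 = x i := rfl
  simp only [Set.mem_preimage, leftmostSet, afterSet, box, separatedSet, Set.mem_ofPred_eq, hx, hx1]
  have h1 : (∀ j, top (x i) < top (x (i.succAbove j))) ↔ ∀ j ≠ i, top (x i) < top (x j) := by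
    rw [Fin.forall_iff_succAbove (P := fun j => j ≠ i → top (x i) < top (x j)) i]
    simp [Fin.succAbove_ne]
  have h2 : (∀ j a, x j a ∈ Set.Ioc 0 l) ↔
      (∀ a, x i a ∈ Set.Ioc 0 l) ∧ ∀ j a, x (i.succAbove j) a ∈ Set.Ioc 0 l :=
    Fin.forall_iff_succAbove i
  have h3 : (∀ j ≠ i, top (x i) < top (x j)) → (HasSeparated (k + 1) x ↔
      HasSeparatedAfter (top (x i)) k (MeasurableEquiv.piFinSuccAbove (fun _ => Fin r → ℝ) i x).2) := by
    intro h
    refine hasSeparated_succ_iff fun j => ?_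
    by_cases hj : j = i
    · rw [hj]
    · exact (h j hj).le
  rw [h1, h2]
  tauto

theorem volume_separatedSet_succ [NeZero r] (n : ℕ) (l : ℝ) (k : ℕ) :
    volume (separatedSet r (Fin (n + 1)) (Set.Ioc 0 l) (k + 1)) =
      (n + 1) * ∫⁻ e in box r l, volume (afterSet r (Fin n) l (top e) k) := by
  have hae : separatedSet r (Fin (n + 1)) (Set.Ioc 0 l) (k + 1) =ᵐ[volume]
      ⋃ i, MeasurableEquiv.piFinSuccAbove (fun _ => Fin r → ℝ) i ⁻¹' leftmostSet r n l k := by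
    refine Filter.eventuallyEq_set.2 ?_
    filter_upwards [ae_injective_uncurry] with x hx
    rw [Set.mem_iUnion]
    simp only [mem_preimage_leftmostSet_iff]
    refine ⟨fun h => ?_, fun ⟨i, hi⟩ => hi.2⟩
    obtain ⟨i, hi⟩ := Finite.exists_min fun j => top (x j)
    refine ⟨i, fun j hj => lt_of_le_of_ne (hi j) fun h => hj ?_, h⟩
    obtain ⟨a, ha⟩ := exists_eq_top (x i)
    obtain ⟨b, hb⟩ := exists_eq_top (x j)
    have : (i, a) = (j, b) := hx (by simp only [ha, hb, h])
    exact (congrArg Prod.fst this).symm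
  have hmp := fun i => volume_preserving_piFinSuccAbove (fun _ : Fin (n + 1) => Fin r → ℝ) i
  have hP := measurableSet_leftmostSet (r := r) n l k
  rw [measure_congr hae, measure_iUnion, tsum_fintype,
    Finset.sum_congr rfl fun i _ => (hmp i).measure_preimage hP.nullMeasurableSet]
  · simp [volume_leftmostSet]
  · intro i j hij
    refine Set.disjoint_left.2 fun x hx hx' => ?_
    rw [mem_preimage_leftmostSet_iff] at hx hx'
    exact lt_asymm (hx.1 j hij.symm) (hx'.1 i hij)
  · exact fun i => (hmp i).measurable hP

/-! ### The exponential generating function -/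

/-- The exponential generating function of `longRatio r k`, evaluated at `l ^ r`. -/
noncomputable def egf (r k : ℕ) (l : ℝ) : ℝ≥0∞ :=
  ∑' n : ℕ, ENNReal.ofReal l ^ (r * n) * longRatio r k n * (n.factorial : ℝ≥0∞)⁻¹

theorem tsum_sum_antidiagonal (f g : ℕ → ℝ≥0∞) :
    ∑' n, ∑ p ∈ Finset.HasAntidiagonal.antidiagonal n, f p.1 * g p.2 = (∑' n, f n) * ∑' n, g n := by
  have h1 : (∑' n, f n) * ∑' n, g n = ∑' p : ℕ × ℕ, f p.1 * g p.2 := by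
    rw [ENNReal.tsum_prod (f := fun n m => f n * g m), ← ENNReal.tsum_mul_right]
    exact tsum_congr fun n => ENNReal.tsum_mul_left.symm
  rw [h1, ← Finset.HasAntidiagonal.sigmaAntidiagonalEquivProd.tsum_eq, ENNReal.tsum_sigma']
  refine tsum_congr fun n => ?_
  rw [← Finset.tsum_subtype]
  rfl

theorem tsum_pow_mul_inv_factorial {s : ℝ} (hs : 0 ≤ s) :
    ∑' n : ℕ, ENNReal.ofReal s ^ n * (n.factorial : ℝ≥0∞)⁻¹ = ENNReal.ofReal (Real.exp s) := by
  rw [Real.exp_eq_exp_ℝ, NormedSpace.exp_eq_tsum_div,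
    ENNReal.ofReal_tsum_of_nonneg (fun n => by positivity) (Real.summable_pow_div_factorial s)]
  refine tsum_congr fun n => ?_
  rw [ENNReal.ofReal_div_of_pos (by positivity), ENNReal.ofReal_pow hs, ENNReal.ofReal_natCast,
    div_eq_mul_inv]

theorem choose_mul_inv_factorial {n m : ℕ} (h : m ≤ n) :
    (n.choose m : ℝ≥0∞) * (n.factorial : ℝ≥0∞)⁻¹ =
      (m.factorial : ℝ≥0∞)⁻¹ * ((n - m).factorial : ℝ≥0∞)⁻¹ := by
  have hf : ∀ n : ℕ, (n.factorial : ℝ≥0∞) ≠ 0 := fun n => by exact_mod_cast n.factorial_ne_zero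
  have ht : ∀ n : ℕ, (n.factorial : ℝ≥0∞) ≠ ∞ := fun n => ENNReal.natCast_ne_top _
  have hc : (n.choose m : ℝ≥0∞) * (m.factorial * (n - m).factorial) = n.factorial := by
    rw [← mul_assoc]
    exact_mod_cast Nat.choose_mul_factorial_mul_factorial h
  rw [← ENNReal.mul_inv (Or.inl (hf m)) (Or.inl (ht m))]
  refine ENNReal.eq_inv_of_mul_eq_one_left ?_
  rw [mul_right_comm, hc, ENNReal.mul_inv_cancel (hf n) (ht n)]

theorem tsum_volume_afterSet [NeZero r] {l y : ℝ} (hy : 0 ≤ y) (hyl : y ≤ l) (k : ℕ) :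
    ∑' n : ℕ, volume (afterSet r (Fin n) l y k) * (n.factorial : ℝ≥0∞)⁻¹ =
      egf r k (l - y) * ENNReal.ofReal (Real.exp (l ^ r - y ^ r - (l - y) ^ r)) := by
  have hs : 0 ≤ l ^ r - y ^ r - (l - y) ^ r := by
    have h := pow_add_pow_le hy (sub_nonneg.2 hyl) (NeZero.ne r)
    rw [add_sub_cancel] at h
    linarith
  rw [← tsum_pow_mul_inv_factorial hs, egf, ← tsum_sum_antidiagonal]
  refine tsum_congr fun n => ?_
  rw [volume_afterSet (Fintype.card_fin n) hy, volume_straddle hy hyl,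
    Finset.Nat.sum_antidiagonal_eq_sum_range_succ_mk, Finset.sum_mul]
  refine Finset.sum_congr rfl fun m hm => ?_
  have h := choose_mul_inv_factorial (Nat.lt_succ_iff.1 (Finset.mem_range.1 hm))
  calc _ = ENNReal.ofReal (l - y) ^ (r * m) * longRatio r k m *
        ENNReal.ofReal (l ^ r - y ^ r - (l - y) ^ r) ^ (n - m) *
        ((n.choose m : ℝ≥0∞) * (n.factorial : ℝ≥0∞)⁻¹) := by ring
    _ = _ := by rw [h]; ring

theorem longRatio_zero_left [NeZero r] (n : ℕ) : longRatio r 0 n = 1 := by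
  have ht := totalMatchings_pos (r := r) n
  have : longCount r 0 n = totalMatchings r n :=
    Nat.card_congr (Equiv.subtypeEquivRight fun M => by simp)
  rw [longRatio, this, ENNReal.div_self (by exact_mod_cast ht.ne') (ENNReal.natCast_ne_top _)]

theorem longRatio_succ_zero [NeZero r] (k : ℕ) : longRatio r (k + 1) 0 = 0 := by
  have h := volume_separatedSet (r := r) (ι := Fin 0) (Fintype.card_fin 0)
    (MeasurableSet.empty) (k + 1)
  have he : separatedSet r (Fin 0) ∅ (k + 1) = ∅ := by
    ext x
    simp only [separatedSet, Set.mem_ofPred_eq, Set.mem_empty_iff_false, iff_false, not_and]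
    rintro - ⟨S, hS, -⟩
    have := S.card_le_univ
    simp [hS] at this
  rw [he] at h
  simpa using h.symm

theorem egf_succ [NeZero r] (l : ℝ) (k : ℕ) :
    egf r (k + 1) l = ∫⁻ e in box r l, egf r k (l - top e) *
      ENNReal.ofReal (Real.exp (l ^ r - top e ^ r - (l - top e) ^ r)) := by
  have h0 : ∀ n : ℕ, ENNReal.ofReal l ^ (r * (n + 1)) * longRatio r (k + 1) (n + 1) *
      ((n + 1).factorial : ℝ≥0∞)⁻¹ =
      ∫⁻ e in box r l, volume (afterSet r (Fin n) l (top e) k) * (n.factorial : ℝ≥0∞)⁻¹ := by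
    intro n
    have h := volume_separatedSet (r := r) (Fintype.card_fin (n + 1))
      (measurableSet_Ioc (a := (0 : ℝ)) (b := l)) (k + 1)
    rw [Real.volume_Ioc, sub_zero] at h
    rw [← h, volume_separatedSet_succ, lintegral_mul_const' _ _
      (ENNReal.inv_ne_top.2 (by exact_mod_cast n.factorial_ne_zero)), Nat.factorial_succ]
    push_cast
    have h1 : (n : ℝ≥0∞) + 1 ≠ 0 := by simp
    have h2 : (n : ℝ≥0∞) + 1 ≠ ∞ := by simp
    rw [ENNReal.mul_inv (Or.inl h1) (Or.inl h2), mul_right_comm, ← mul_assoc,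
      ENNReal.mul_inv_cancel h1 h2, one_mul, mul_comm]
  rw [egf, tsum_eq_zero_add' ENNReal.summable, longRatio_succ_zero, mul_zero, zero_mul, zero_add]
  simp_rw [h0]
  rw [← lintegral_tsum]
  · refine setLIntegral_congr_fun (measurableSet_box_Ioc l) fun e he => ?_
    have := top_mem_of_mem_box he
    exact tsum_volume_afterSet this.1.le this.2 k
  · intro n
    refine AEMeasurable.mul_const ?_ _
    rw [← aemeasurable_indicator_iff (measurableSet_box_Ioc l)]
    exact (measurable_volume_afterSet n l k).aemeasurable

theorem egf_zero [NeZero r] {l : ℝ} (hl : 0 ≤ l) :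
    egf r 0 l = ENNReal.ofReal (Real.exp (l ^ r)) := by
  rw [← tsum_pow_mul_inv_factorial (pow_nonneg hl r), egf]
  refine tsum_congr fun n => ?_
  rw [longRatio_zero_left, mul_one, pow_mul, ENNReal.ofReal_pow hl]

/-- The Poissonized probability of having an aligned sub-matching of size `k`. -/
noncomputable def poissonRatio (r k : ℕ) (l : ℝ) : ℝ≥0∞ :=
  ENNReal.ofReal (Real.exp (-l ^ r)) * egf r k l

theorem poissonRatio_zero [NeZero r] {l : ℝ} (hl : 0 ≤ l) : poissonRatio r 0 l = 1 := by
  rw [poissonRatio, egf_zero hl, ← ENNReal.ofReal_mul (Real.exp_pos _).le, ← Real.exp_add]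
  simp

theorem poissonRatio_succ [NeZero r] (l : ℝ) (k : ℕ) :
    poissonRatio r (k + 1) l = ∫⁻ e in box r l,
      ENNReal.ofReal (Real.exp (-top e ^ r)) * poissonRatio r k (l - top e) := by
  rw [poissonRatio, egf_succ, ← lintegral_const_mul' _ _ ENNReal.ofReal_ne_top]
  refine lintegral_congr fun e => ?_
  simp only [poissonRatio]
  rw [mul_left_comm, ← ENNReal.ofReal_mul (Real.exp_pos _).le, ← Real.exp_add, ← mul_assoc,
    ← ENNReal.ofReal_mul (Real.exp_pos _).le, ← Real.exp_add, mul_comm]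
  ring_nf

/-! ### The law of the gap between consecutive separated tuples -/

/-- The tuples with positive entries. -/
def orthant (r : ℕ) : Set (Fin r → ℝ) := {e | ∀ a, e a ∈ Set.Ioi 0}

theorem measurableSet_orthant : MeasurableSet (orthant r) :=
  measurableSet_box _ measurableSet_Ioi

theorem top_pos [NeZero r] {e : Fin r → ℝ} (he : e ∈ orthant r) : 0 < top e :=
  (he 0 : 0 < e 0).trans_le (le_top e 0)

theorem mem_box_iff [NeZero r] {l : ℝ} {e : Fin r → ℝ} :
    e ∈ box r l ↔ e ∈ orthant r ∧ top e ≤ l := by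
  simp only [box, orthant, top_le_iff, Set.mem_ofPred_eq, Set.mem_Ioc, Set.mem_Ioi, forall_and]

theorem rpow_inv_pow [NeZero r] {u : ℝ} (hu : 0 ≤ u) : (u ^ ((1 : ℝ) / r)) ^ r = u := by
  rw [one_div, Real.rpow_inv_natCast_pow hu (NeZero.ne r)]

theorem pow_rpow_inv [NeZero r] {u : ℝ} (hu : 0 ≤ u) : (u ^ r) ^ ((1 : ℝ) / r) = u := by
  rw [one_div, Real.pow_rpow_inv_natCast hu (NeZero.ne r)]

theorem map_top_pow [NeZero r] :
    (volume.restrict (orthant r)).map (fun e => top e ^ r) = volume.restrict (Set.Ioi 0) := by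
  have hm : Measurable fun e : Fin r → ℝ => top e ^ r := measurable_top.pow_const r
  have hIic : ∀ b : ℝ, (volume.restrict (orthant r)).map (fun e => top e ^ r) (Set.Iic b) =
      ENNReal.ofReal b := by
    intro b
    rw [Measure.map_apply hm measurableSet_Iic, Measure.restrict_apply (hm measurableSet_Iic)]
    rcases le_or_gt b 0 with hb | hb
    · rw [ENNReal.ofReal_of_nonpos hb]
      convert measure_empty (μ := volume) using 2
      refine Set.eq_empty_of_forall_notMem fun e he => ?_
      exact absurd he.1 (not_le.2 (hb.trans_lt (pow_pos (top_pos he.2) r)))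
    · have : (fun e : Fin r → ℝ => top e ^ r) ⁻¹' Set.Iic b ∩ orthant r =
          box r (b ^ ((1 : ℝ) / r)) := by
        ext e
        rw [mem_box_iff, Set.mem_inter_iff, and_comm]
        refine and_congr_right fun he => ?_
        rw [Set.mem_preimage, Set.mem_Iic,
          ← pow_le_pow_iff_left₀ (top_pos he).le (Real.rpow_nonneg hb.le _) (NeZero.ne r),
          rpow_inv_pow hb.le]
      rw [this, box, volume_box, Real.volume_Ioc, sub_zero,
        ← ENNReal.ofReal_pow (Real.rpow_nonneg hb.le _), rpow_inv_pow hb.le]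
  have hIoc : ∀ a b : ℝ, a < b →
      (volume.restrict (orthant r)).map (fun e => top e ^ r) (Set.Ioc a b) =
        ENNReal.ofReal b - ENNReal.ofReal a := by
    intro a b hab
    rw [← Set.Iic_sdiff_Iic, measure_sdiff (Set.Iic_subset_Iic.2 hab.le)
      measurableSet_Iic.nullMeasurableSet (by simp [hIic]), hIic, hIic]
  refine Measure.ext_of_Ioc' _ _ (fun a b hab => ?_) fun a b hab => ?_
  · rw [hIoc a b hab]
    exact (tsub_le_self.trans_lt ENNReal.ofReal_lt_top).ne
  · rw [hIoc a b hab, Measure.restrict_apply measurableSet_Ioc, Set.Ioc_inter_Ioi,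
      Real.volume_Ioc, sup_comm, max_def]
    split_ifs with ha
    · rw [ENNReal.ofReal_sub _ ha]
    · rw [ENNReal.ofReal_of_nonpos (not_le.1 ha).le, tsub_zero, sub_zero]

/-- The standard exponential distribution. -/
noncomputable def expLaw : Measure ℝ :=
  (volume.restrict (Set.Ioi 0)).withDensity fun u => ENNReal.ofReal (Real.exp (-u))

/-- The law of `u ^ (1 / r)` for a standard exponential variable `u`. -/
noncomputable def gapLaw (r : ℕ) : Measure ℝ := expLaw.map fun u => u ^ ((1 : ℝ) / r)

theorem measurable_exp_neg : Measurable fun u : ℝ => ENNReal.ofReal (Real.exp (-u)) := by fun_prop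

theorem measurable_rpow_inv : Measurable fun u : ℝ => u ^ ((1 : ℝ) / r) :=
  measurable_id.pow_const _

theorem lintegral_gapLaw [NeZero r] {g : ℝ → ℝ≥0∞} (hg : Measurable g) :
    ∫⁻ t, g t ∂gapLaw r =
      ∫⁻ e in orthant r, ENNReal.ofReal (Real.exp (-top e ^ r)) * g (top e) := by
  have hg' : Measurable fun u : ℝ => g (u ^ ((1 : ℝ) / r)) := hg.comp measurable_rpow_inv
  rw [gapLaw, lintegral_map hg measurable_rpow_inv, expLaw,
    lintegral_withDensity_eq_lintegral_mul _ measurable_exp_neg hg', ← map_top_pow (r := r),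
    lintegral_map (measurable_exp_neg.mul hg') (measurable_top.pow_const r)]
  refine setLIntegral_congr_fun measurableSet_orthant fun e he => ?_
  simp only [Pi.mul_apply, pow_rpow_inv (top_pos he).le]

theorem integrable_expLaw_iff {g : ℝ → ℝ} :
    Integrable g expLaw ↔ IntegrableOn (fun u => Real.exp (-u) * g u) (Set.Ioi 0) := by
  rw [expLaw, integrable_withDensity_iff_integrable_smul' measurable_exp_neg (by simp)]
  simp only [ENNReal.toReal_ofReal (Real.exp_pos _).le, smul_eq_mul, IntegrableOn]

theorem integral_expLaw (g : ℝ → ℝ) :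
    ∫ u, g u ∂expLaw = ∫ u in Set.Ioi 0, Real.exp (-u) * g u := by
  rw [expLaw, integral_withDensity_eq_integral_toReal_smul measurable_exp_neg (by simp)]
  simp only [ENNReal.toReal_ofReal (Real.exp_pos _).le, smul_eq_mul]

instance : IsProbabilityMeasure expLaw := by
  constructor
  have hi : IntegrableOn (fun u : ℝ => Real.exp (-u)) (Set.Ioi 0) := by
    simpa using exp_neg_integrableOn_Ioi 0 one_pos
  rw [expLaw, withDensity_apply _ .univ, Measure.restrict_univ,
    ← ofReal_integral_eq_lintegral_ofReal hi (.of_forall fun u => (Real.exp_pos _).le),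
    integral_exp_neg_Ioi_zero, ENNReal.ofReal_one]

instance : IsProbabilityMeasure (gapLaw r) :=
  Measure.isProbabilityMeasure_map measurable_rpow_inv.aemeasurable

theorem integral_gapLaw [NeZero r] : ∫ t, t ∂gapLaw r = Real.Gamma (((r : ℝ) + 1) / r) := by
  have hr : (r : ℝ) ≠ 0 := Nat.cast_ne_zero.2 (NeZero.ne r)
  rw [gapLaw, integral_map measurable_rpow_inv.aemeasurable
    measurable_id'.aestronglyMeasurable, integral_expLaw,
    Real.Gamma_eq_integral (by positivity)]
  congr! 4
  field_simp
  ring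

theorem integrable_exp_mul_gapLaw [NeZero r] {θ : ℝ} (hθ : |θ| < 1) :
    Integrable (fun t => Real.exp (θ * t)) (gapLaw r) := by
  have hm : Measurable fun t : ℝ => Real.exp (θ * t) := by fun_prop
  rw [gapLaw, integrable_map_measure hm.aestronglyMeasurable measurable_rpow_inv.aemeasurable,
    integrable_expLaw_iff]
  have h := (exp_neg_integrableOn_Ioi 0 (sub_pos.2 hθ)).const_mul (Real.exp |θ|)
  refine Integrable.mono' h ?_ ?_
  · exact ((Real.measurable_exp.comp measurable_neg).mul
      (hm.comp measurable_rpow_inv)).aestronglyMeasurable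
  · refine (ae_restrict_iff' measurableSet_Ioi).2 (.of_forall fun u (hu : 0 < u) => ?_)
    have h0 : 0 ≤ u ^ ((1 : ℝ) / r) := Real.rpow_nonneg hu.le _
    have h1 : u ^ ((1 : ℝ) / r) ≤ 1 + u := by
      by_contra! hc
      have := pow_le_pow_left₀ (by linarith) hc.le r
      rw [rpow_inv_pow hu.le] at this
      have := one_add_mul_le_pow (a := u) (by linarith) r
      have hr1 : (1 : ℝ) ≤ r := by exact_mod_cast NeZero.one_le
      nlinarith
    have h2 : θ * u ^ ((1 : ℝ) / r) ≤ |θ| * (1 + u) :=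
      (mul_le_mul_of_nonneg_right (le_abs_self θ) h0).trans
        (mul_le_mul_of_nonneg_left h1 (abs_nonneg θ))
    rw [Function.comp_apply, Real.norm_of_nonneg (mul_pos (Real.exp_pos _) (Real.exp_pos _)).le,
      ← Real.exp_add, ← Real.exp_add, Real.exp_le_exp]
    linarith

theorem hasDerivAt_mgf_gapLaw [NeZero r] :
    HasDerivAt (ProbabilityTheory.mgf id (gapLaw r)) (Real.Gamma (((r : ℝ) + 1) / r)) 0 := by
  have h : (0 : ℝ) ∈ interior (ProbabilityTheory.integrableExpSet id (gapLaw r)) := by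
    rw [mem_interior]
    refine ⟨Set.Ioo (-1) 1, fun θ hθ => ?_, isOpen_Ioo, by simp⟩
    exact integrable_exp_mul_gapLaw (abs_lt.2 hθ)
  have := ProbabilityTheory.hasDerivAt_mgf h
  simpa [integral_gapLaw] using this

theorem hasDerivAt_mgf_mul_exp [NeZero r] (c : ℝ) :
    HasDerivAt (fun θ => ProbabilityTheory.mgf id (gapLaw r) θ * Real.exp (-(θ * c)))
      (Real.Gamma (((r : ℝ) + 1) / r) - c) 0 := by
  have h1 : HasDerivAt (fun θ : ℝ => Real.exp (-(θ * c))) (-c) 0 := by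
    simpa using ((hasDerivAt_id (0 : ℝ)).mul_const c).neg.exp
  have h2 := (hasDerivAt_mgf_gapLaw (r := r)).fun_mul h1
  simpa [sub_eq_add_neg] using h2

theorem exists_mgf_lt_of_gt [NeZero r] {c : ℝ} (hc : Real.Gamma (((r : ℝ) + 1) / r) < c) :
    ∃ θ : ℝ, 0 < θ ∧ θ < 1 ∧ ProbabilityTheory.mgf id (gapLaw r) θ < Real.exp (θ * c) := by
  have h := (hasDerivAt_iff_tendsto_slope.1 (hasDerivAt_mgf_mul_exp (r := r) c)).mono_left
    (nhdsGT_le_nhdsNE 0)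
  have h1 := h.eventually (gt_mem_nhds (sub_neg.2 hc))
  obtain ⟨θ, hs, hθ⟩ := (h1.and (Ioo_mem_nhdsGT (one_pos (α := ℝ)))).exists
  refine ⟨θ, hθ.1, hθ.2, ?_⟩
  rw [slope_def_field, sub_zero, div_lt_iff₀ hθ.1] at hs
  simp only [ProbabilityTheory.mgf_zero, zero_mul, neg_zero, Real.exp_zero, mul_one, sub_neg] at hs
  rwa [Real.exp_neg, ← div_eq_mul_inv, div_lt_one (Real.exp_pos _)] at hs

theorem exists_mgf_lt_of_lt [NeZero r] {c : ℝ} (hc : c < Real.Gamma (((r : ℝ) + 1) / r)) :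
    ∃ θ : ℝ, 0 < θ ∧ θ < 1 ∧ ProbabilityTheory.mgf id (gapLaw r) (-θ) < Real.exp (-(θ * c)) := by
  have h := (hasDerivAt_iff_tendsto_slope.1 (hasDerivAt_mgf_mul_exp (r := r) c)).mono_left
    (nhdsLT_le_nhdsNE 0)
  have h1 := h.eventually (lt_mem_nhds (sub_pos.2 hc))
  obtain ⟨θ, hs, hθ⟩ := (h1.and (Ioo_mem_nhdsLT (neg_one_lt_zero (R := ℝ)))).exists
  refine ⟨-θ, neg_pos.2 hθ.2, by linarith [hθ.1], ?_⟩
  rw [slope_def_field, sub_zero, lt_div_iff_of_neg hθ.2] at hs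
  simp only [ProbabilityTheory.mgf_zero, zero_mul, neg_zero, Real.exp_zero, mul_one, sub_neg] at hs
  rwa [neg_neg, neg_mul, neg_neg, ← div_lt_one (Real.exp_pos _), div_eq_mul_inv, ← Real.exp_neg]

theorem lintegral_exp_mul_gapLaw [NeZero r] {θ : ℝ} (hθ : |θ| < 1) :
    ∫⁻ t, ENNReal.ofReal (Real.exp (θ * t)) ∂gapLaw r =
      ENNReal.ofReal (ProbabilityTheory.mgf id (gapLaw r) θ) :=
  (ofReal_integral_eq_lintegral_ofReal (integrable_exp_mul_gapLaw hθ)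
    (.of_forall fun _ => (Real.exp_pos _).le)).symm

/-! ### Chernoff bounds for the Poissonized model -/

theorem measurable_poissonRatio (k : ℕ) : Measurable (poissonRatio r k) := by
  unfold poissonRatio egf
  refine Measurable.mul (by fun_prop) (Measurable.tsum fun n => ?_)
  fun_prop

theorem poissonRatio_succ_eq_lintegral_gapLaw [NeZero r] (l : ℝ) (k : ℕ) :
    poissonRatio r (k + 1) l = ∫⁻ t in Set.Iic l, poissonRatio r k (l - t) ∂gapLaw r := by
  have hm : Measurable fun t => poissonRatio r k (l - t) :=
    (measurable_poissonRatio k).comp (measurable_const.sub measurable_id)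
  rw [← lintegral_indicator measurableSet_Iic,
    lintegral_gapLaw (hm.indicator measurableSet_Iic), poissonRatio_succ,
    ← lintegral_indicator (measurableSet_box_Ioc l),
    ← lintegral_indicator measurableSet_orthant]
  refine lintegral_congr fun e => ?_
  by_cases he : e ∈ orthant r <;> by_cases hl : top e ≤ l <;>
    simp [Set.indicator_apply, mem_box_iff, he, hl]

theorem poissonRatio_le [NeZero r] {θ : ℝ} (h0 : 0 ≤ θ) (h1 : θ < 1) (k : ℕ) {l : ℝ}
    (hl : 0 ≤ l) :
    poissonRatio r k l ≤ ENNReal.ofReal (Real.exp (θ * l)) *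
      ENNReal.ofReal (ProbabilityTheory.mgf id (gapLaw r) (-θ)) ^ k := by
  induction k generalizing l with
  | zero =>
    rw [poissonRatio_zero hl, pow_zero, mul_one, ENNReal.one_le_ofReal, Real.one_le_exp_iff]
    positivity
  | succ k ih =>
    set m := ENNReal.ofReal (ProbabilityTheory.mgf id (gapLaw r) (-θ)) with hm
    rw [poissonRatio_succ_eq_lintegral_gapLaw]
    calc _ ≤ ∫⁻ t in Set.Iic l, ENNReal.ofReal (Real.exp (θ * l)) * m ^ k *
          ENNReal.ofReal (Real.exp (-θ * t)) ∂gapLaw r := by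
          refine setLIntegral_mono' measurableSet_Iic fun t (ht : t ≤ l) => ?_
          refine (ih (sub_nonneg.2 ht)).trans_eq ?_
          rw [mul_right_comm, ← ENNReal.ofReal_mul (Real.exp_pos _).le, ← Real.exp_add]
          ring_nf
      _ ≤ ∫⁻ t, ENNReal.ofReal (Real.exp (θ * l)) * m ^ k *
          ENNReal.ofReal (Real.exp (-θ * t)) ∂gapLaw r := setLIntegral_le_lintegral _ _
      _ = _ := by
        rw [lintegral_const_mul _ (by fun_prop),
          lintegral_exp_mul_gapLaw (by rwa [abs_neg, abs_of_nonneg h0]), ← hm, pow_succ, mul_assoc]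

theorem ae_gapLaw_nonneg : ∀ᵐ t ∂gapLaw r, 0 ≤ t := by
  rw [gapLaw, ae_map_iff measurable_rpow_inv.aemeasurable measurableSet_Ici]
  refine (withDensity_absolutelyContinuous _ _).ae_le ?_
  exact (ae_restrict_iff' measurableSet_Ioi).2 (.of_forall fun u hu => Real.rpow_nonneg hu.le _)

theorem one_le_mgf_gapLaw [NeZero r] {θ : ℝ} (h0 : 0 ≤ θ) (h1 : θ < 1) :
    1 ≤ ENNReal.ofReal (ProbabilityTheory.mgf id (gapLaw r) θ) := by
  rw [← lintegral_exp_mul_gapLaw (by rwa [abs_of_nonneg h0])]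
  calc (1 : ℝ≥0∞) = ∫⁻ _, 1 ∂gapLaw r := by simp
    _ ≤ _ := by
      refine lintegral_mono_ae (ae_gapLaw_nonneg.mono fun t ht => ?_)
      rw [ENNReal.one_le_ofReal, Real.one_le_exp_iff]
      positivity

theorem one_le_poissonRatio_add [NeZero r] {θ : ℝ} (h0 : 0 ≤ θ) (h1 : θ < 1) (k : ℕ) {l : ℝ}
    (hl : 0 ≤ l) :
    1 ≤ poissonRatio r k l + ENNReal.ofReal (Real.exp (-(θ * l))) *
      ENNReal.ofReal (ProbabilityTheory.mgf id (gapLaw r) θ) ^ k := by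
  induction k generalizing l with
  | zero => exact le_add_right (poissonRatio_zero hl).ge
  | succ k ih =>
    have hm1 := one_le_pow₀ (one_le_mgf_gapLaw (r := r) h0 h1) (n := k)
    set m := ENNReal.ofReal (ProbabilityTheory.mgf id (gapLaw r) θ) with hm
    rw [poissonRatio_succ_eq_lintegral_gapLaw, ← lintegral_indicator measurableSet_Iic]
    have he : ENNReal.ofReal (Real.exp (-(θ * l))) * m ^ (k + 1) =
        ∫⁻ t, ENNReal.ofReal (Real.exp (-(θ * l))) * m ^ k *
          ENNReal.ofReal (Real.exp (θ * t)) ∂gapLaw r := by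
      rw [lintegral_const_mul _ (by fun_prop),
        lintegral_exp_mul_gapLaw (by rwa [abs_of_nonneg h0]), ← hm, pow_succ, mul_assoc]
    rw [he, ← lintegral_add_right _ (by fun_prop)]
    calc (1 : ℝ≥0∞) = ∫⁻ _, 1 ∂gapLaw r := by simp
      _ ≤ _ := by
        refine lintegral_mono fun t => ?_
        have hc : ENNReal.ofReal (Real.exp (-(θ * l))) * m ^ k *
            ENNReal.ofReal (Real.exp (θ * t)) =
            ENNReal.ofReal (Real.exp (-(θ * (l - t)))) * m ^ k := by
          rw [mul_right_comm, ← ENNReal.ofReal_mul (Real.exp_pos _).le, ← Real.exp_add]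
          ring_nf
        simp only [hc]
        by_cases ht : t ≤ l
        · rw [Set.indicator_of_mem (by exact ht)]
          exact ih (sub_nonneg.2 ht)
        · refine le_add_left (one_le_mul ?_ hm1)
          rw [ENNReal.one_le_ofReal, Real.one_le_exp_iff]
          nlinarith [not_le.1 ht]

/-! ### De-Poissonization -/

theorem volume_separatedSet_unit [NeZero r] (n k : ℕ) :
    volume (separatedSet r (Fin n) (Set.Ioc 0 1) k) = longRatio r k n := by
  rw [volume_separatedSet (Fintype.card_fin n) measurableSet_Ioc, Real.volume_Ioc]
  simp

theorem monotone_longRatio [NeZero r] (k : ℕ) : Monotone (longRatio r k) := by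
  refine monotone_nat_of_le_succ fun n => ?_
  have hmp := volume_preserving_piFinSuccAbove (fun _ : Fin (n + 1) => Fin r → ℝ) 0
  have hm : MeasurableSet (box r 1 ×ˢ separatedSet r (Fin n) (Set.Ioc 0 1) k) :=
    (measurableSet_box_Ioc 1).prod (measurableSet_separatedSet measurableSet_Ioc k)
  have hv : volume (box r 1 ×ˢ separatedSet r (Fin n) (Set.Ioc 0 1) k) = longRatio r k n := by
    rw [Measure.volume_eq_prod, Measure.prod_prod, volume_separatedSet_unit, box, volume_box,
      Real.volume_Ioc]
    simp
  rw [← hv, ← hmp.measure_preimage hm.nullMeasurableSet, ← volume_separatedSet_unit]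
  refine measure_mono fun x hx => ?_
  obtain ⟨h0, h1, S, hS, hx⟩ := hx
  refine ⟨Fin.forall_fin_succ.2 ⟨h0, h1⟩, S.map (Fin.succEmb n), by simp [hS], ?_⟩
  intro i hi j hj hij
  obtain ⟨i, hi', rfl⟩ := Finset.mem_map.1 hi
  obtain ⟨j, hj', rfl⟩ := Finset.mem_map.1 hj
  exact hx i hi' j hj' fun h => hij (h ▸ rfl)

/-- The probability that a Poisson variable of mean `s` equals `n`. -/
noncomputable def poissonWeight (s : ℝ) (n : ℕ) : ℝ≥0∞ :=
  ENNReal.ofReal (Real.exp (-s)) * (ENNReal.ofReal s ^ n * (n.factorial : ℝ≥0∞)⁻¹)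

theorem tsum_poissonWeight {s : ℝ} (hs : 0 ≤ s) : ∑' n, poissonWeight s n = 1 := by
  simp only [poissonWeight]
  rw [ENNReal.tsum_mul_left, tsum_pow_mul_inv_factorial hs,
    ← ENNReal.ofReal_mul (Real.exp_pos _).le, ← Real.exp_add, neg_add_cancel, Real.exp_zero,
    ENNReal.ofReal_one]

theorem poissonRatio_eq_tsum {l : ℝ} (hl : 0 ≤ l) (k : ℕ) :
    poissonRatio r k l = ∑' n, poissonWeight (l ^ r) n * longRatio r k n := by
  rw [poissonRatio, egf, ← ENNReal.tsum_mul_left]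
  refine tsum_congr fun n => ?_
  rw [poissonWeight, ENNReal.ofReal_pow hl, ← pow_mul]
  ring

theorem tsum_indicator_poissonWeight_le {t : ℝ} (ht : 0 < t) {n : ℕ} {A : Set ℕ}
    (hA : ∀ m ∈ A, t ^ m ≤ t ^ n) :
    ∑' m, A.indicator (poissonWeight (t * n)) m ≤ ENNReal.ofReal ((t * Real.exp (1 - t)) ^ n) := by
  have h : ∀ m, A.indicator (poissonWeight (t * n)) m ≤
      ENNReal.ofReal (Real.exp (-(t * n)) * t ^ n) *
        (ENNReal.ofReal n ^ m * (m.factorial : ℝ≥0∞)⁻¹) := by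
    intro m
    refine Set.indicator_apply_le' (fun hm => ?_) fun _ => zero_le
    rw [poissonWeight, ENNReal.ofReal_mul ht.le, mul_pow, mul_assoc,
      ENNReal.ofReal_mul (Real.exp_pos _).le, mul_assoc, ← ENNReal.ofReal_pow ht.le]
    exact mul_le_mul' le_rfl (mul_le_mul' (ENNReal.ofReal_le_ofReal (hA m hm)) le_rfl)
  refine (ENNReal.tsum_le_tsum h).trans_eq ?_
  rw [ENNReal.tsum_mul_left, tsum_pow_mul_inv_factorial n.cast_nonneg, ← ENNReal.ofReal_mul
    (mul_pos (Real.exp_pos _) (pow_pos ht n)).le, mul_pow, ← Real.exp_nat_mul, mul_right_comm,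
    ← Real.exp_add, mul_comm]
  ring_nf

theorem longRatio_le_poissonRatio_add [NeZero r] {t l : ℝ} (ht : 1 ≤ t) (hl : 0 ≤ l) {n : ℕ}
    (hln : l ^ r = t * n) (k : ℕ) :
    longRatio r k n ≤ poissonRatio r k l + ENNReal.ofReal ((t * Real.exp (1 - t)) ^ n) := by
  have ht0 : 0 < t := one_pos.trans_le ht
  have hA : ∀ m ∈ Set.Iio n, t ^ m ≤ t ^ n := fun m hm => pow_le_pow_right₀ ht (le_of_lt hm)
  refine le_trans ?_ (add_le_add_right (tsum_indicator_poissonWeight_le ht0 hA) _)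
  rw [poissonRatio_eq_tsum hl, hln, ← ENNReal.tsum_add]
  calc longRatio r k n = ∑' m, poissonWeight (t * n) m * longRatio r k n := by
        rw [ENNReal.tsum_mul_right, tsum_poissonWeight (by positivity), one_mul]
    _ ≤ _ := by
      refine ENNReal.tsum_le_tsum fun m => ?_
      by_cases hm : m < n
      · rw [Set.indicator_of_mem (by exact hm)]
        exact le_add_left (mul_le_of_le_one_right' (longRatio_le_one k n))
      · exact le_add_right (mul_le_mul_right (monotone_longRatio k (not_lt.1 hm)) _)

theorem poissonRatio_le_longRatio_add [NeZero r] {t l : ℝ} (ht0 : 0 < t) (ht : t ≤ 1)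
    (hl : 0 ≤ l) {n : ℕ} (hln : l ^ r = t * n) (k : ℕ) :
    poissonRatio r k l ≤ longRatio r k n + ENNReal.ofReal ((t * Real.exp (1 - t)) ^ n) := by
  have hA : ∀ m ∈ Set.Ioi n, t ^ m ≤ t ^ n :=
    fun m hm => pow_le_pow_of_le_one ht0.le ht (le_of_lt hm)
  refine le_trans ?_ (add_le_add_right (tsum_indicator_poissonWeight_le ht0 hA) _)
  have h : longRatio r k n = ∑' m, poissonWeight (t * n) m * longRatio r k n := by
    rw [ENNReal.tsum_mul_right, tsum_poissonWeight (by positivity), one_mul]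
  rw [poissonRatio_eq_tsum hl, hln, h, ← ENNReal.tsum_add]
  refine ENNReal.tsum_le_tsum fun m => ?_
  by_cases hm : n < m
  · rw [Set.indicator_of_mem (by exact hm)]
    exact le_add_left (mul_le_of_le_one_right' (longRatio_le_one k m))
  · exact le_add_right (mul_le_mul_right (monotone_longRatio k (not_lt.1 hm)) _)

theorem tendsto_ofReal_mul_exp_pow {t : ℝ} (ht0 : 0 < t) (ht : t ≠ 1) :
    Tendsto (fun n : ℕ => ENNReal.ofReal ((t * Real.exp (1 - t)) ^ n)) atTop (𝓝 0) := by
  rw [← ENNReal.ofReal_zero]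
  refine ENNReal.tendsto_ofReal (tendsto_pow_atTop_nhds_zero_of_lt_one (by positivity) ?_)
  have h := Real.add_one_lt_exp (sub_ne_zero.2 ht)
  rw [sub_add_cancel] at h
  calc t * Real.exp (1 - t) < Real.exp (t - 1) * Real.exp (1 - t) :=
        mul_lt_mul_of_pos_right h (Real.exp_pos _)
    _ = 1 := by rw [← Real.exp_add]; simp

/-! ### Asymptotics -/

theorem tendsto_rpow_inv_natCast [NeZero r] :
    Tendsto (fun n : ℕ => (n : ℝ) ^ ((1 : ℝ) / r)) atTop atTop := by
  have hr : 0 < (r : ℝ) := Nat.cast_pos.2 (NeZero.pos r)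
  exact (tendsto_rpow_atTop (by positivity)).comp tendsto_natCast_atTop_atTop

theorem tendsto_ofReal_exp_linear [NeZero r] {p : ℝ} (hp : p < 0) (q : ℝ) :
    Tendsto (fun n : ℕ => ENNReal.ofReal (Real.exp (p * (n : ℝ) ^ ((1 : ℝ) / r) + q)))
      atTop (𝓝 0) := by
  rw [← ENNReal.ofReal_zero]
  refine ENNReal.tendsto_ofReal (Real.tendsto_exp_atBot.comp ?_)
  exact tendsto_atBot_add_const_right _ _ (tendsto_rpow_inv_natCast.const_mul_atTop_of_neg hp)

theorem ofReal_exp_mul_pow_le {s m c : ℝ} (h : m ≤ Real.exp c) (k : ℕ) :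
    ENNReal.ofReal (Real.exp s) * ENNReal.ofReal m ^ k ≤ ENNReal.ofReal (Real.exp (s + c * k)) := by
  rw [Real.exp_add, mul_comm c, Real.exp_nat_mul, ENNReal.ofReal_mul (Real.exp_pos _).le,
    ENNReal.ofReal_pow (Real.exp_pos _).le]
  gcongr

theorem tendsto_longRatio_zero [NeZero r] {a : ℝ} (ha : 0 < a)
    (haΓ : 1 < a * Real.Gamma (((r : ℝ) + 1) / r)) {k : ℕ → ℕ}
    (hk : ∀ n : ℕ, a * (n : ℝ) ^ ((1 : ℝ) / r) ≤ k n) :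
    Tendsto (fun n => longRatio r (k n) n) atTop (𝓝 0) := by
  obtain ⟨c, hc1, hc2⟩ := exists_between ((div_lt_iff₀' ha).2 haΓ)
  obtain ⟨t, ht1, ht2⟩ := exists_between ((div_lt_iff₀' ha).1 hc1)
  obtain ⟨θ, hθ0, hθ1, hθ⟩ := exists_mgf_lt_of_lt (r := r) hc2
  have hc : 0 < c := (div_pos one_pos ha).trans hc1
  have ht0 : 0 < t := one_pos.trans ht1
  have hlim := (tendsto_ofReal_exp_linear (r := r) (mul_neg_of_pos_of_neg hθ0 (sub_neg.2 ht2))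
    0).add (tendsto_ofReal_mul_exp_pow ht0 ht1.ne')
  rw [add_zero] at hlim
  refine tendsto_of_tendsto_of_tendsto_of_le_of_le tendsto_const_nhds hlim (fun _ => zero_le)
    fun n => ?_
  set x := (n : ℝ) ^ ((1 : ℝ) / r) with hx
  have hx0 : 0 ≤ x := Real.rpow_nonneg n.cast_nonneg _
  have hl0 : 0 ≤ t ^ ((1 : ℝ) / r) * x := mul_nonneg (Real.rpow_nonneg ht0.le _) hx0
  have hl1 : t ^ ((1 : ℝ) / r) ≤ t := by
    refine (Real.rpow_le_rpow_of_exponent_le ht1.le ?_).trans_eq (Real.rpow_one t)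
    exact div_le_one_of_le₀ (by exact_mod_cast NeZero.one_le) (Nat.cast_nonneg r)
  refine (longRatio_le_poissonRatio_add ht1.le hl0 (by
    rw [mul_pow, rpow_inv_pow ht0.le, hx, rpow_inv_pow n.cast_nonneg]) (k n)).trans ?_
  refine add_le_add_left ?_ _
  refine (poissonRatio_le hθ0.le hθ1 (k n) hl0).trans ?_
  refine (ofReal_exp_mul_pow_le hθ.le (k n)).trans ?_
  refine ENNReal.ofReal_le_ofReal (Real.exp_le_exp.2 ?_)
  have h1 := mul_le_mul_of_nonneg_left (mul_le_mul_of_nonneg_right hl1 hx0) hθ0.le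
  have h2 := mul_le_mul_of_nonneg_left (hk n) (mul_pos hθ0 hc).le
  linarith

theorem tendsto_longRatio_one [NeZero r] {a : ℝ} (ha : 0 ≤ a)
    (haΓ : a * Real.Gamma (((r : ℝ) + 1) / r) < 1) {k : ℕ → ℕ}
    (hk : ∀ n : ℕ, (k n : ℝ) ≤ a * (n : ℝ) ^ ((1 : ℝ) / r) + 1) :
    Tendsto (fun n => longRatio r (k n) n) atTop (𝓝 1) := by
  have hΓ : 0 < Real.Gamma (((r : ℝ) + 1) / r) := by
    have : (0 : ℝ) < r := Nat.cast_pos.2 (NeZero.pos r)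
    exact Real.Gamma_pos_of_pos (by positivity)
  obtain ⟨c, hc1, hc2⟩ : ∃ c, Real.Gamma (((r : ℝ) + 1) / r) < c ∧ a * c < 1 := by
    have h : ∀ᶠ c in 𝓝[>] Real.Gamma (((r : ℝ) + 1) / r), a * c < 1 :=
      ((continuous_const_mul a).tendsto _).eventually_lt_const haΓ |>.filter_mono
        nhdsWithin_le_nhds
    obtain ⟨c, h1, h2⟩ := (h.and self_mem_nhdsWithin).exists
    exact ⟨c, h2, h1⟩
  obtain ⟨t, ht1, ht2⟩ := exists_between hc2
  obtain ⟨θ, hθ0, hθ1, hθ⟩ := exists_mgf_lt_of_gt (r := r) hc1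
  have hc : 0 < c := hΓ.trans hc1
  have ht0 : 0 < t := (mul_nonneg ha hc.le).trans_lt ht1
  have hlim := (tendsto_ofReal_exp_linear (r := r) (mul_neg_of_pos_of_neg hθ0 (sub_neg.2 ht1))
    (θ * c)).add (tendsto_ofReal_mul_exp_pow ht0 ht2.ne)
  rw [add_zero] at hlim
  have hlim' := ENNReal.Tendsto.sub (tendsto_const_nhds (x := (1 : ℝ≥0∞))) hlim
    (Or.inl ENNReal.one_ne_top)
  rw [tsub_zero] at hlim'
  refine tendsto_of_tendsto_of_tendsto_of_le_of_le hlim' tendsto_const_nhds (fun n => ?_)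
    fun n => longRatio_le_one (k n) n
  set x := (n : ℝ) ^ ((1 : ℝ) / r) with hx
  have hx0 : 0 ≤ x := Real.rpow_nonneg n.cast_nonneg _
  have hl0 : 0 ≤ t ^ ((1 : ℝ) / r) * x := mul_nonneg (Real.rpow_nonneg ht0.le _) hx0
  have hl1 : t ≤ t ^ ((1 : ℝ) / r) := by
    refine (Real.rpow_one t).symm.trans_le (Real.rpow_le_rpow_of_exponent_ge ht0 ht2.le ?_)
    exact div_le_one_of_le₀ (by exact_mod_cast NeZero.one_le) (Nat.cast_nonneg r)
  refine tsub_le_iff_right.2 ?_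
  refine (one_le_poissonRatio_add (r := r) hθ0.le hθ1 (k n) hl0).trans ?_
  rw [add_comm (ENNReal.ofReal _), ← add_assoc]
  refine add_le_add (poissonRatio_le_longRatio_add ht0 ht2.le hl0 (by
    rw [mul_pow, rpow_inv_pow ht0.le, hx, rpow_inv_pow n.cast_nonneg]) (k n)) ?_
  refine (ofReal_exp_mul_pow_le hθ.le (k n)).trans ?_
  refine ENNReal.ofReal_le_ofReal (Real.exp_le_exp.2 ?_)
  have h1 := mul_le_mul_of_nonneg_left (mul_le_mul_of_nonneg_right hl1 hx0) hθ0.le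
  have h2 := mul_le_mul_of_nonneg_left (hk n) (mul_pos hθ0 hc).le
  linarith

theorem deviantMatchings_add_longCount_le {b ε x : ℝ} {n k₁ k₂ : ℕ}
    (hx : x = (n : ℝ) ^ ((1 : ℝ) / r)) (hx0 : 0 < x)
    (h₁ : ∀ m : ℕ, (b + ε) * x ≤ m → k₁ ≤ m) (h₂ : ∀ m : ℕ, (m : ℝ) ≤ (b - ε) * x → m < k₂) :
    deviantMatchings r (alignPattern r) b ε n + longCount r k₂ n ≤
      longCount r k₁ n + totalMatchings r n := by
  have hfin := finite_matchings r n
  let X := {M : Finset (Finset ℕ) // IsOrderedMatching r n M}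
  have hcard : ∀ p : Finset (Finset ℕ) → Prop,
      Nat.card {M : Finset (Finset ℕ) // IsOrderedMatching r n M ∧ p M} =
        Set.ncard {M : X | p M.1} := fun p =>
    Nat.card_congr (Equiv.subtypeSubtypeEquivSubtypeInter (IsOrderedMatching r n) p).symm
  rw [deviantMatchings, longCount, longCount, totalMatchings, hcard, hcard, hcard,
    ← Set.ncard_univ]
  set D : Set X := {M | ε ≤ |(cliqueSize (alignPattern r) M.1 : ℝ) / (n : ℝ) ^ ((1 : ℝ) / r) - b|}
  set L₁ : Set X := {M | k₁ ≤ cliqueSize (alignPattern r) M.1}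
  set L₂ : Set X := {M | k₂ ≤ cliqueSize (alignPattern r) M.1}
  have hDL : D ∩ L₂ ⊆ L₁ := by
    rintro M ⟨hD, hL⟩
    have hD : ε ≤ |(cliqueSize (alignPattern r) M.1 : ℝ) / (n : ℝ) ^ ((1 : ℝ) / r) - b| := hD
    rw [← hx] at hD
    rcases le_abs'.1 hD with h | h
    · have := h₂ (cliqueSize (alignPattern r) M.1) (by rw [← div_le_iff₀ hx0]; linarith)
      exact absurd hL (not_le.2 this)
    · exact h₁ _ (by rw [← le_div_iff₀ hx0]; linarith)
  rw [← Set.ncard_union_add_ncard_inter D L₂, add_comm]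
  exact add_le_add (Set.ncard_le_ncard hDL) (Set.ncard_le_ncard (Set.subset_univ _))

theorem toReal_longRatio (k n : ℕ) :
    (longRatio r k n).toReal = longCount r k n / totalMatchings r n := by
  simp [longRatio]

theorem cliqueSizeConvergesTo_align [NeZero r] :
    CliqueSizeConvergesTo r (alignPattern r) (1 / Real.Gamma (((r : ℝ) + 1) / (r : ℝ))) := by
  intro ε hε
  have hΓ : 0 < Real.Gamma (((r : ℝ) + 1) / r) := by
    have : (0 : ℝ) < r := Nat.cast_pos.2 (NeZero.pos r)
    exact Real.Gamma_pos_of_pos (by positivity)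
  set μ := Real.Gamma (((r : ℝ) + 1) / r)
  have hb : 0 < 1 / μ := by positivity
  set a := max (1 / μ - ε) 0 with ha
  have h1 := tendsto_longRatio_zero (r := r) (a := 1 / μ + ε) (by positivity)
    (by rw [← div_lt_iff₀ hΓ]; linarith)
    (k := fun n => ⌈(1 / μ + ε) * (n : ℝ) ^ ((1 : ℝ) / r)⌉₊) fun n => Nat.le_ceil _
  have h2 := tendsto_longRatio_one (r := r) (a := a) (le_max_right _ _)
    (by rw [← lt_div_iff₀ hΓ]; exact max_lt (by linarith) hb)
    (k := fun n => ⌊a * (n : ℝ) ^ ((1 : ℝ) / r)⌋₊ + 1) fun n => by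
      push_cast
      gcongr
      exact Nat.floor_le (mul_nonneg (le_max_right _ _) (Real.rpow_nonneg n.cast_nonneg _))
  have hlim := ((ENNReal.tendsto_toReal ENNReal.zero_ne_top).comp h1).add
    (((ENNReal.tendsto_toReal ENNReal.one_ne_top).comp h2).const_sub 1)
  simp only [Function.comp_def, toReal_longRatio, ENNReal.toReal_zero, ENNReal.toReal_one,
    sub_self, add_zero] at hlim
  refine tendsto_of_tendsto_of_tendsto_of_le_of_le' tendsto_const_nhds hlim
    (.of_forall fun n => by positivity) ?_
  filter_upwards [eventually_gt_atTop 0] with n hn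
  have hx : 0 < (n : ℝ) ^ ((1 : ℝ) / r) := Real.rpow_pos_of_pos (Nat.cast_pos.2 hn) _
  have ht : (0 : ℝ) < totalMatchings r n := Nat.cast_pos.2 (totalMatchings_pos n)
  have h := deviantMatchings_add_longCount_le (r := r) (b := 1 / μ) (ε := ε) rfl hx
    (fun m hm => Nat.ceil_le.2 hm) (k₂ := ⌊a * (n : ℝ) ^ ((1 : ℝ) / r)⌋₊ + 1) fun m hm =>
      Nat.lt_succ_of_le (Nat.le_floor (hm.trans
        (mul_le_mul_of_nonneg_right (le_max_left _ _) hx.le)))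
  have h' : (deviantMatchings r (alignPattern r) (1 / μ) ε n : ℝ) +
      longCount r (⌊a * (n : ℝ) ^ ((1 : ℝ) / r)⌋₊ + 1) n ≤
      longCount r ⌈(1 / μ + ε) * (n : ℝ) ^ ((1 : ℝ) / r)⌉₊ n + totalMatchings r n := by
    exact_mod_cast h
  rw [one_sub_div ht.ne', ← add_div]
  exact div_le_div_of_nonneg_right (by linarith) ht.le

end RandomMatching

/-- **Proposition 1.8(1).** Fix `r ≥ 2` and let `P` be the generalised
alignment `r`-pattern (the unique collectable `r`-pattern of type `r`). For a
uniformly random ordered `r`-matching `M_n` of size `n`, `L_P(M_n)/n^(1/r)`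
converges in probability to `1/Γ((r+1)/r)`. -/
theorem random_matching_alignment_limit (r : ℕ) (hr : 2 ≤ r) :
    CliqueSizeConvergesTo r (alignPattern r)
      (1 / Real.Gamma (((r : ℝ) + 1) / (r : ℝ))) := by
  have : NeZero r := ⟨by omega⟩
  exact RandomMatching.cliqueSizeConvergesTo_align
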